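/- In the critical case θ = 1, for every ρ > 0, the Yule-Simon tail satisfies the upper bound limsup_{n→∞} n^{-1/3} ln P(X_{1,ρ} > n) ≤ −(1/2)^{1/3}·ρ^{2/3}. -/

import Mathlib

open MeasureTheory ProbabilityTheory

/-- A realization of the two-parameter Yule–Simon model: a counting process `Y`
started from one individual whose jump intensity is the fertility `F`, where
`F(t) = Y(t) − θ∫₀^t F(s)ds` (i.e. each individual of age `a` gives birth at rate
`e^{-θa}`, so `Y` is the general branching process `Y_θ`), together with an
independent exponential time `T` of rate `ρ`. The Yule–Simon variable is
`X_{θ,ρ} = Y(T)`. -/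
structure YuleSimonSetup (θ ρ : ℝ) where
  Ω : Type
  mΩ : MeasurableSpace Ω
  P : Measure Ω
  isProb : IsProbabilityMeasure P
  ℱ : Filtration ℝ mΩ
  Y : ℝ → Ω → ℕ
  F : ℝ → Ω → ℝ
  T : Ω → ℝ
  /-- joint measurability of the process -/
  measY : Measurable fun p : ℝ × Ω => Y p.1 p.2
  measF : Measurable fun p : ℝ × Ω => F p.1 p.2
  /-- the population starts from a single ancestor -/
  Y0 : ∀ ω, Y 0 ω = 1
  /-- paths are non-decreasing on `[0,∞)` -/
  mono : ∀ ω, MonotoneOn (fun t => Y t ω) (Set.Ici 0)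
  /-- paths are right-continuous (piecewise constant) -/
  rightCont : ∀ ω, ∀ t ≥ (0:ℝ), ∃ ε > 0, ∀ s ∈ Set.Ico t (t + ε), Y s ω = Y t ω
  /-- all jumps have unit size: the process passes through every intermediate value -/
  unitJumps : ∀ ω, ∀ t ≥ (0:ℝ), ∀ k : ℕ, 1 ≤ k → k ≤ Y t ω → ∃ s ∈ Set.Icc 0 t, Y s ω = k
  /-- the fertility solves `F(t) = Y(t) − θ∫₀^t F(s)ds` -/
  F_def : ∀ ω, ∀ t ≥ (0:ℝ), F t ω = (Y t ω : ℝ) - θ * ∫ s in (0:ℝ)..t, F s ω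
  adapted : Adapted ℱ fun t ω => (Y t ω : ℝ)
  integrableY : ∀ t, Integrable (fun ω => (Y t ω : ℝ)) P
  integrableF : ∀ t, Integrable (fun ω => ∫ s in (0:ℝ)..t, F s ω) P
  /-- `Y(t) − ∫₀^t F(s)ds` is a martingale: `F` is the intensity of the counting
  process `Y`, which characterizes `Y` as the general branching process `Y_θ`. -/
  martingale : ∀ s t : ℝ, 0 ≤ s → s ≤ t →
    (P[fun ω => (Y t ω : ℝ) - ∫ u in (0:ℝ)..t, F u ω | ℱ s])
      =ᵐ[P] fun ω => (Y s ω : ℝ) - ∫ u in (0:ℝ)..s, F u ω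
  measT : Measurable T
  /-- `T` is exponentially distributed with parameter `ρ` -/
  lawT : ∀ t : ℝ, 0 ≤ t → P {ω | T ω ≤ t} = ENNReal.ofReal (1 - Real.exp (-ρ * t))
  /-- `T` is independent of the branching process -/
  indepT : IndepFun T (fun ω => fun t : ℝ => Y t ω) P

namespace YuleSimonSetup

attribute [instance] YuleSimonSetup.mΩ YuleSimonSetup.isProb

/-- The tail probability `P(X_{θ,ρ} > n)` of the two-parameter Yule–Simon law. -/
noncomputable def tail {θ ρ : ℝ} (S : YuleSimonSetup θ ρ) (n : ℕ) : ENNReal :=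
  S.P {ω | n < S.Y (S.T ω) ω}

end YuleSimonSetup

namespace YuleSimonSetup

variable {ρ : ℝ}

/-- integrated fertility -/
noncomputable def A (S : YuleSimonSetup 1 ρ) (t : ℝ) (ω : S.Ω) : ℝ := ∫ s in (0:ℝ)..t, S.F s ω

lemma F_eq (S : YuleSimonSetup 1 ρ) (ω : S.Ω) {t : ℝ} (ht : 0 ≤ t) :
    S.F t ω = (S.Y t ω : ℝ) - S.A t ω := by
  have := S.F_def ω t ht
  simpa [A] using this

lemma Y_mono (S : YuleSimonSetup 1 ρ) (ω : S.Ω) {s t : ℝ} (hs : 0 ≤ s) (hst : s ≤ t) :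
    S.Y s ω ≤ S.Y t ω := S.mono ω hs (hs.trans hst : (0:ℝ) ≤ t) hst

lemma barrier (S : YuleSimonSetup 1 ρ) (ω : S.Ω) {t : ℝ} (ht : 0 ≤ t)
    (hi : IntervalIntegrable (fun s => S.F s ω) volume 0 t) : S.A t ω ≤ S.Y t ω := by
  by_contra hcon
  push Not at hcon
  have hcont : ContinuousOn (fun r => S.A r ω) (Set.Icc 0 t) := by
    have := intervalIntegral.continuousOn_primitive_interval (μ := volume)
      (f := fun s => S.F s ω) (a := 0) (b := t) (by
        rw [Set.uIcc_of_le ht]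
        rwa [intervalIntegrable_iff_integrableOn_Icc_of_le ht] at hi)
    rwa [Set.uIcc_of_le ht] at this
  let c : ℝ := S.Y t ω
  have hcl : IsCompact {r ∈ Set.Icc 0 t | S.A r ω ≤ c} := by
    have : IsClosed (Set.Icc 0 t ∩ (fun r => S.A r ω) ⁻¹' Set.Iic c) :=
      hcont.preimage_isClosed_of_isClosed isClosed_Icc isClosed_Iic
    exact isCompact_Icc.of_isClosed_subset this (fun x hx => hx.1)
  have hne : {r ∈ Set.Icc 0 t | S.A r ω ≤ c}.Nonempty :=
    ⟨0, ⟨le_refl _, ht⟩, by simp [A, c]⟩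
  obtain ⟨s, ⟨⟨hs0, hst⟩, hsc⟩, hmax⟩ := hcl.exists_isGreatest hne
  have hneg : ∀ r ∈ Set.Ioc s t, S.F r ω ≤ 0 := by
    intro r hr
    have h0 : 0 ≤ r := hs0.trans hr.1.le
    have h1 : c < S.A r ω := by
      by_contra h
      push Not at h
      exact absurd (hmax ⟨⟨h0, hr.2⟩, h⟩) (not_le.mpr hr.1)
    have h2 : (S.Y r ω : ℝ) ≤ c := by
      simp only [c]; exact_mod_cast S.Y_mono ω h0 hr.2
    rw [S.F_eq ω h0]; linarith
  have hsplit : S.A t ω = S.A s ω + ∫ r in s..t, S.F r ω := by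
    unfold A
    rw [intervalIntegral.integral_add_adjacent_intervals]
    · exact hi.mono_set (by rw [Set.uIcc_of_le hs0, Set.uIcc_of_le ht]; exact Set.Icc_subset_Icc le_rfl hst)
    · exact hi.mono_set (by rw [Set.uIcc_of_le hst, Set.uIcc_of_le ht]; exact Set.Icc_subset_Icc hs0 le_rfl)
  have hle : ∫ r in s..t, S.F r ω ≤ 0 := by
    rw [intervalIntegral.integral_of_le hst]
    exact setIntegral_nonpos measurableSet_Ioc hneg
  linarith

lemma F_bound (S : YuleSimonSetup 1 ρ) (ω : S.Ω) {t : ℝ} (ht : 0 ≤ t) :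
    0 ≤ S.F t ω ∧ S.F t ω ≤ S.Y t ω := by
  by_cases hi : IntervalIntegrable (fun s => S.F s ω) volume 0 t
  · have h1 := S.barrier ω ht hi
    have h2 : 0 ≤ S.A t ω := by
      unfold A
      apply intervalIntegral.integral_nonneg ht
      intro r hr
      have := S.barrier ω hr.1 (hi.mono_set (by
        rw [Set.uIcc_of_le hr.1, Set.uIcc_of_le ht]; exact Set.Icc_subset_Icc le_rfl hr.2))
      rw [S.F_eq ω hr.1]; linarith
    rw [S.F_eq ω ht]
    constructor <;> linarith
  · have : S.A t ω = 0 := intervalIntegral.integral_undef hi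
    rw [S.F_eq ω ht, this]
    constructor <;> simp

lemma F_intble (S : YuleSimonSetup 1 ρ) (ω : S.Ω) {s t : ℝ} (hs : 0 ≤ s) (ht : s ≤ t) :
    IntervalIntegrable (fun s => S.F s ω) volume s t := by
  rw [intervalIntegrable_iff_integrableOn_Icc_of_le ht]
  have hm : Measurable (fun s => S.F s ω) := S.measF.comp (measurable_id.prodMk measurable_const)
  refine Measure.integrableOn_of_bounded (M := (S.Y t ω : ℝ)) (by simp) hm.aestronglyMeasurable ?_
  refine (ae_restrict_iff' measurableSet_Icc).2 (Filter.Eventually.of_forall fun r hr => ?_)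
  have h := S.F_bound ω (hs.trans hr.1)
  rw [Real.norm_eq_abs, abs_of_nonneg h.1]
  refine h.2.trans ?_
  exact_mod_cast S.Y_mono ω (hs.trans hr.1) hr.2

lemma A_add (S : YuleSimonSetup 1 ρ) (ω : S.Ω) {s t : ℝ} (hs : 0 ≤ s) (ht : s ≤ t) :
    S.A t ω = S.A s ω + ∫ r in s..t, S.F r ω := by
  unfold A
  rw [intervalIntegral.integral_add_adjacent_intervals (S.F_intble ω le_rfl hs) (S.F_intble ω hs ht)]

lemma A_mono (S : YuleSimonSetup 1 ρ) (ω : S.Ω) {s t : ℝ} (hs : 0 ≤ s) (ht : s ≤ t) :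
    S.A s ω ≤ S.A t ω := by
  rw [S.A_add ω hs ht]
  have := intervalIntegral.integral_nonneg (f := fun r => S.F r ω) (μ := volume) ht
    (fun r hr => (S.F_bound ω (hs.trans hr.1)).1)
  linarith

lemma A_nonneg (S : YuleSimonSetup 1 ρ) (ω : S.Ω) {t : ℝ} (ht : 0 ≤ t) : 0 ≤ S.A t ω := by
  have := S.A_mono ω le_rfl ht
  simpa [A] using this

lemma A_le (S : YuleSimonSetup 1 ρ) (ω : S.Ω) {t : ℝ} (ht : 0 ≤ t) : S.A t ω ≤ S.Y t ω := by
  have := (S.F_bound ω ht).1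
  rw [S.F_eq ω ht] at this; linarith

lemma A_upper (S : YuleSimonSetup 1 ρ) (ω : S.Ω) {s t : ℝ} (hs : 0 ≤ s) (ht : s ≤ t) :
    S.A t ω - S.A s ω ≤ ((S.Y t ω : ℝ) - S.A s ω) * (t - s) := by
  rw [S.A_add ω hs ht]
  have : ∫ r in s..t, S.F r ω ≤ ∫ r in s..t, ((S.Y t ω : ℝ) - S.A s ω) := by
    apply intervalIntegral.integral_mono_on ht (S.F_intble ω hs ht) (by simp)
    intro r hr
    rw [S.F_eq ω (hs.trans hr.1)]
    have h1 := S.A_mono ω hs hr.1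
    have h2 : (S.Y r ω : ℝ) ≤ S.Y t ω := by exact_mod_cast S.Y_mono ω (hs.trans hr.1) hr.2
    linarith
  rw [intervalIntegral.integral_const, smul_eq_mul] at this
  linarith

lemma A_lower (S : YuleSimonSetup 1 ρ) (ω : S.Ω) {s t : ℝ} (hs : 0 ≤ s) (ht : s ≤ t)
    (hY : S.Y t ω = S.Y s ω) :
    ((S.Y s ω : ℝ) - S.A s ω) * ((t - s) - (t - s) ^ 2) ≤ S.A t ω - S.A s ω := by
  have hu := S.A_upper ω hs ht
  rw [hY] at hu
  have : ∫ r in s..t, ((S.Y s ω : ℝ) - S.A t ω) ≤ ∫ r in s..t, S.F r ω := by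
    apply intervalIntegral.integral_mono_on ht (by simp) (S.F_intble ω hs ht)
    intro r hr
    rw [S.F_eq ω (hs.trans hr.1)]
    have h1 := S.A_mono ω (hs.trans hr.1) hr.2
    have h2 : (S.Y s ω : ℝ) ≤ S.Y r ω := by exact_mod_cast S.Y_mono ω hs hr.1
    linarith
  rw [intervalIntegral.integral_const, smul_eq_mul] at this
  have h3 := S.A_add ω hs ht
  nlinarith [sub_nonneg.2 ht]

/-- pathwise one step estimate -/
lemma step_det (ρ : ℝ) (hρ : 0 < ρ) (n : ℕ) (v : ℕ → ℝ → ℝ) (C κ : ℝ) (hC : 0 ≤ C)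
    (hvκ : ∀ k, n < k → ∀ a, v k a = κ)
    (hvb : ∀ (k : ℕ) (a : ℝ), 0 ≤ a → a ≤ k → |v k a| ≤ C)
    (hvL : ∀ (k : ℕ) (a b : ℝ), 0 ≤ a → a ≤ k → 0 ≤ b → b ≤ k → |v k a - v k b| ≤ C * |a - b|)
    (hvs : ∀ (k : ℕ) (a δ : ℝ), k ≤ n → 0 ≤ a → a ≤ k → 0 ≤ δ → δ ≤ 1 →
      Real.exp (-ρ * δ) * v k (a + (k - a) * δ) - v k a + (v (k+1) a - v k a) * ((k - a) * δ)
        ≤ C * δ ^ 2)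
    (k j : ℕ) (a b δ : ℝ) (hk : k ≤ n) (ha : 0 ≤ a) (hak : a ≤ k) (hab : a ≤ b)
    (hbk : b ≤ ((k + j : ℕ) : ℝ)) (hδ : 0 ≤ δ) (hδ1 : δ ≤ 1)
    (hup : b - a ≤ (((k + j : ℕ) : ℝ) - a) * δ)
    (hlo : j = 0 → ((k:ℝ) - a) * (δ - δ ^ 2) ≤ b - a) :
    (if k + j ≤ n then Real.exp (-ρ * δ) * v (k + j) b else κ) ≤
      v k a + (v (k+1) a - v k a) * (j - (b - a))
        + C * (10 + ρ + 3 * n) * (δ ^ 2 + δ * j + (if 2 ≤ j then (j:ℝ) else 0)) := by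
  have hkn : (k:ℝ) ≤ n := by exact_mod_cast hk
  have hn0 : (0:ℝ) ≤ n := by positivity
  have hk1 : |v (k+1) a| ≤ C := hvb (k+1) a ha (by push_cast; linarith)
  have hk0 : |v k a| ≤ C := hvb k a ha hak
  have he0 : 0 < Real.exp (-ρ * δ) := Real.exp_pos _
  have he1 : Real.exp (-ρ * δ) ≤ 1 := Real.exp_le_one_iff.2 (by nlinarith)
  have he2 : 1 - ρ * δ ≤ Real.exp (-ρ * δ) := by
    have := Real.add_one_le_exp (-ρ * δ); linarith
  have hD : |v (k+1) a - v k a| ≤ 2 * C := by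
    rw [abs_le] at *; constructor <;> linarith
  rcases Nat.lt_or_ge j 1 with hj | hj
  · obtain rfl : j = 0 := by omega
    simp only [add_zero] at *
    rw [if_pos hk]
    have hlo := hlo trivial
    have hc0 : 0 ≤ a + (k - a) * δ := by nlinarith
    have hck : a + (k - a) * δ ≤ k := by nlinarith
    have h1 := hvs k a δ hk ha hak hδ hδ1
    have h2 := hvL k b (a + (k - a) * δ) (ha.trans hab) hbk hc0 hck
    have h3 : |b - (a + (k - a) * δ)| ≤ n * δ ^ 2 := by
      rw [abs_le]
      constructor <;> nlinarith [sq_nonneg δ]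
    have h4 : v k b - v k (a + (k - a) * δ) ≤ C * (n * δ ^ 2) :=
      (le_abs_self _).trans (h2.trans (by gcongr))
    have h5 : Real.exp (-ρ * δ) * (v k b - v k (a + (k - a) * δ)) ≤ C * (n * δ ^ 2) := by
      have : 0 ≤ C * (n * δ ^ 2) := by positivity
      nlinarith
    have h6 : (v (k+1) a - v k a) * ((b - a) - (k - a) * δ) ≤ 2 * C * (n * δ ^ 2) := by
      refine (le_abs_self _).trans ?_
      rw [abs_mul]
      have : b - a - (k - a) * δ = b - (a + (k - a) * δ) := by ring
      rw [this]
      gcongr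
    have h7 : 0 ≤ C * δ ^ 2 * (9 + ρ) := by positivity
    simp only [Nat.cast_zero, mul_zero, add_zero, show ¬ (2 ≤ 0) by norm_num, if_false]
    nlinarith
  · rcases Nat.lt_or_ge j 2 with hj2 | hj2
    · obtain rfl : j = 1 := by omega
      have hba : b - a ≤ (n + 1) * δ := by
        refine hup.trans ?_
        gcongr; push_cast; linarith
      have h1 : (if k + 1 ≤ n then Real.exp (-ρ * δ) * v (k + 1) b else κ) ≤
          v (k+1) a + C * (b - a) + C * ρ * δ := by
        split_ifs with hkk
        · have h2 := hvL (k+1) b a (ha.trans hab) hbk ha (by push_cast; linarith)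
          rw [abs_of_nonneg (sub_nonneg.2 hab)] at h2
          have h3 := (le_abs_self _).trans h2
          have h4 := hvb (k+1) b (ha.trans hab) hbk
          rw [abs_le] at h4
          nlinarith
        · rw [hvκ (k+1) (by omega) a]
          have : 0 ≤ C * (b - a) := mul_nonneg hC (by linarith)
          have : 0 ≤ C * ρ * δ := by positivity
          linarith
      have h6 : (v (k+1) a - v k a) * (b - a) ≤ 2 * C * (b - a) := by
        have : v (k+1) a - v k a ≤ 2 * C := (le_abs_self _).trans hD
        gcongr
      have h7 : 3 * C * (b - a) ≤ 3 * C * ((n + 1) * δ) := by gcongr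
      have h8 : 0 ≤ C * δ ^ 2 * (10 + ρ + 3 * n) := by positivity
      have h9 : 0 ≤ C * δ := by positivity
      simp only [Nat.cast_one, show ¬ (2 ≤ 1) by norm_num, if_false]
      nlinarith
    · have hj2' : (2:ℝ) ≤ j := by exact_mod_cast hj2
      have h1 : (if k + j ≤ n then Real.exp (-ρ * δ) * v (k + j) b else κ) ≤ C := by
        have h4 := hvb (k+j) b (ha.trans hab) hbk
        rw [abs_le] at h4
        split_ifs with hkk
        · nlinarith
        · rw [hvκ (k+j) (by omega) b] at h4; exact h4.2
      have hba : b - a ≤ n + j := by push_cast at hbk; linarith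
      have h6 : -(2 * C * (n + j + j)) ≤ (v (k+1) a - v k a) * (j - (b - a)) := by
        refine (neg_le_neg ?_).trans (neg_abs_le _)
        rw [abs_mul]
        gcongr
        rw [abs_le]; constructor <;> linarith
      rw [if_pos hj2]
      rw [abs_le] at hk0
      have h8 : 0 ≤ C * (10 + ρ + 3 * n) * (δ ^ 2 + δ * j) := by positivity
      have h9 : C * (10 + ρ + 3 * n) * j = C * 10 * j + C * ρ * j + C * 3 * n * j := by ring
      have h10 : 0 ≤ C * ρ * j := by positivity
      have h11 : C * 3 * n * 2 ≤ C * 3 * n * j := by gcongr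
      have h12 : C * 2 ≤ C * j := by gcongr
      have h13 : 0 ≤ C * n := by positivity
      nlinarith

end YuleSimonSetup

open MeasureTheory ProbabilityTheory

namespace YuleSimonSetup

variable {ρ : ℝ}

lemma meas_Yt (S : YuleSimonSetup 1 ρ) (t : ℝ) : Measurable (fun ω => S.Y t ω) :=
  S.measY.comp (measurable_const.prodMk measurable_id)

lemma meas_Yt_filt (S : YuleSimonSetup 1 ρ) (t : ℝ) : Measurable[S.ℱ t] (fun ω => S.Y t ω) := by
  have h := S.adapted t
  have h2 : (fun ω => S.Y t ω) = fun ω => ⌊(S.Y t ω : ℝ)⌋₊ := by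
    ext ω; simp
  rw [h2]
  exact Nat.measurable_floor.comp h

lemma A_aesm (S : YuleSimonSetup 1 ρ) {t : ℝ} (ht : 0 ≤ t) :
    AEStronglyMeasurable[S.ℱ t] (S.A t) S.P := by
  have h1 : AEStronglyMeasurable[S.ℱ t] (fun ω => (S.Y t ω : ℝ) - S.A t ω) S.P :=
    ⟨_, stronglyMeasurable_condExp, (S.martingale t t ht le_rfl).symm⟩
  have h2 : AEStronglyMeasurable[S.ℱ t] (fun ω => (S.Y t ω : ℝ)) S.P :=
    (S.adapted t).stronglyMeasurable.aestronglyMeasurable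
  have := h2.sub h1
  refine this.congr (Filter.Eventually.of_forall fun ω => ?_)
  simp

lemma G_aesm (S : YuleSimonSetup 1 ρ) {t : ℝ} (ht : 0 ≤ t) (G : ℕ → ℝ → ℝ)
    (hG : ∀ k, Measurable (G k)) :
    AEStronglyMeasurable[S.ℱ t] (fun ω => G (S.Y t ω) (S.A t ω)) S.P := by
  obtain ⟨A', hA', hAA⟩ := S.A_aesm ht
  refine ⟨fun ω => G (S.Y t ω) (A' ω), ?_, ?_⟩
  · have h : Measurable (fun p : ℕ × ℝ => G p.1 p.2) := measurable_from_prod_countable_right hG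
    have h2 : Measurable[S.ℱ t] (fun ω => (S.Y t ω, A' ω)) :=
      Measurable.prodMk (S.meas_Yt_filt t) hA'.measurable
    exact (h.comp h2).stronglyMeasurable
  · filter_upwards [hAA] with ω h
    rw [h]

lemma mart_zero (S : YuleSimonSetup 1 ρ) {s t : ℝ} (hs : 0 ≤ s) (hst : s ≤ t) (D : S.Ω → ℝ)
    (hD : AEStronglyMeasurable[S.ℱ s] D S.P) (C : ℝ) (hb : ∀ ω, |D ω| ≤ C) :
    Integrable (fun ω => D ω * (((S.Y t ω : ℝ) - S.Y s ω) - (S.A t ω - S.A s ω))) S.P ∧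
    ∫ ω, D ω * (((S.Y t ω : ℝ) - S.Y s ω) - (S.A t ω - S.A s ω)) ∂S.P = 0 := by
  let M : ℝ → S.Ω → ℝ := fun r ω => (S.Y r ω : ℝ) - S.A r ω
  have hMi : ∀ r, Integrable (M r) S.P := fun r => (S.integrableY r).sub (S.integrableF r)
  have hD0 : AEStronglyMeasurable D S.P := hD.mono (S.ℱ.le s)
  have hDM : ∀ r, Integrable (D * M r) S.P := fun r =>
    (hMi r).bdd_mul hD0 (Filter.Eventually.of_forall fun ω => (by simpa using hb ω : ‖D ω‖ ≤ C))
  have h1 : S.P[D * M t | S.ℱ s] =ᵐ[S.P] D * S.P[M t | S.ℱ s] :=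
    condExp_mul_of_aestronglyMeasurable_left hD (hDM t) (hMi t)
  have h2 : S.P[M t | S.ℱ s] =ᵐ[S.P] M s := S.martingale s t hs hst
  have h3 : ∫ ω, (D * M t) ω ∂S.P = ∫ ω, (D * M s) ω ∂S.P := by
    rw [← integral_condExp (S.ℱ.le s)]
    apply integral_congr_ae
    filter_upwards [h1, h2] with ω ha hb
    rw [ha, Pi.mul_apply, Pi.mul_apply, hb]
  have h4 : (fun ω => D ω * (((S.Y t ω : ℝ) - S.Y s ω) - (S.A t ω - S.A s ω)))
      = fun ω => (D * M t) ω - (D * M s) ω := by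
    ext ω; simp [M]; ring
  rw [h4]
  exact ⟨(hDM t).sub (hDM s), by rw [integral_sub (hDM t) (hDM s), h3, sub_self]⟩

/-- multiple-jump indicator -/
noncomputable def J (S : YuleSimonSetup 1 ρ) (s t : ℝ) (ω : S.Ω) : ℝ :=
  if 2 ≤ S.Y t ω - S.Y s ω then ((S.Y t ω - S.Y s ω : ℕ) : ℝ) else 0

lemma J_nonneg (S : YuleSimonSetup 1 ρ) (s t : ℝ) (ω : S.Ω) : 0 ≤ S.J s t ω := by
  unfold J; split_ifs <;> positivity

lemma J_le (S : YuleSimonSetup 1 ρ) {s t : ℝ} (hs : 0 ≤ s) (hst : s ≤ t) (ω : S.Ω) :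
    S.J s t ω ≤ (S.Y t ω : ℝ) - S.Y s ω := by
  have := S.Y_mono ω hs hst
  unfold J; split_ifs
  · push_cast [this]; exact le_rfl
  · have : (S.Y s ω : ℝ) ≤ S.Y t ω := by exact_mod_cast this
    linarith

lemma J_meas (S : YuleSimonSetup 1 ρ) (s t : ℝ) : Measurable (S.J s t) := by
  have h : Measurable (fun k : ℕ => if 2 ≤ k then (k:ℝ) else 0) := measurable_from_nat
  exact h.comp ((S.meas_Yt t).sub (S.meas_Yt s))

lemma J_int (S : YuleSimonSetup 1 ρ) {s t : ℝ} (hs : 0 ≤ s) (hst : s ≤ t) :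
    Integrable (S.J s t) S.P := by
  refine ((S.integrableY t).sub (S.integrableY s)).mono' (S.J_meas s t).aestronglyMeasurable
    (Filter.Eventually.of_forall fun ω => ?_)
  rw [Real.norm_eq_abs, abs_of_nonneg (S.J_nonneg s t ω)]
  exact S.J_le hs hst ω

/-- expected value of killed functional -/
noncomputable def Z (S : YuleSimonSetup 1 ρ) (n : ℕ) (v : ℕ → ℝ → ℝ) (t : ℝ) : ℝ :=
  ∫ ω, (if S.Y t ω ≤ n then v (S.Y t ω) (S.A t ω) else 0) ∂S.P

/-- crossing event -/
def cross (S : YuleSimonSetup 1 ρ) (n : ℕ) (s t : ℝ) : Set S.Ω :=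
  {ω | S.Y s ω ≤ n ∧ n < S.Y t ω}

lemma cross_meas (S : YuleSimonSetup 1 ρ) (n : ℕ) (s t : ℝ) : MeasurableSet (S.cross n s t) :=
  (measurableSet_le (S.meas_Yt s) measurable_const).inter
    (measurableSet_lt measurable_const (S.meas_Yt t))

lemma Z_int (S : YuleSimonSetup 1 ρ) (n : ℕ) (v : ℕ → ℝ → ℝ) (C : ℝ) (hC : 0 ≤ C)
    (hvm : ∀ k, Measurable (v k))
    (hvb : ∀ (k : ℕ) (a : ℝ), 0 ≤ a → a ≤ k → |v k a| ≤ C) {t : ℝ} (ht : 0 ≤ t) :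
    Integrable (fun ω => if S.Y t ω ≤ n then v (S.Y t ω) (S.A t ω) else 0) S.P := by
  have h := (S.G_aesm ht (fun k a => if k ≤ n then v k a else 0) (fun k => by
    by_cases hk : k ≤ n
    · simpa [hk] using hvm k
    · simp [hk])).mono (S.ℱ.le t)
  refine Integrable.of_bound h C (Filter.Eventually.of_forall fun ω => ?_)
  rw [Real.norm_eq_abs]
  split_ifs
  · exact hvb _ _ (S.A_nonneg ω ht) (S.A_le ω ht)
  · simpa using hC

lemma step_exp (S : YuleSimonSetup 1 ρ) (hρ : 0 < ρ) (n : ℕ) (v : ℕ → ℝ → ℝ) (C κ : ℝ) (hC : 0 ≤ C)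
    (hvm : ∀ k, Measurable (v k))
    (hvκ : ∀ k, n < k → ∀ a, v k a = κ)
    (hvb : ∀ (k : ℕ) (a : ℝ), 0 ≤ a → a ≤ k → |v k a| ≤ C)
    (hvL : ∀ (k : ℕ) (a b : ℝ), 0 ≤ a → a ≤ k → 0 ≤ b → b ≤ k → |v k a - v k b| ≤ C * |a - b|)
    (hvs : ∀ (k : ℕ) (a δ : ℝ), k ≤ n → 0 ≤ a → a ≤ k → 0 ≤ δ → δ ≤ 1 →
      Real.exp (-ρ * δ) * v k (a + (k - a) * δ) - v k a + (v (k+1) a - v k a) * ((k - a) * δ)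
        ≤ C * δ ^ 2)
    {s t δ : ℝ} (hs : 0 ≤ s) (hδ : 0 ≤ δ) (hδ1 : δ ≤ 1) (ht : t = s + δ) :
    Real.exp (-ρ * δ) * S.Z n v t + κ * S.P.real (S.cross n s t) ≤
      S.Z n v s + C * (10 + ρ + 3 * n) *
        (δ ^ 2 + δ * ((∫ ω, (S.Y t ω : ℝ) ∂S.P) - ∫ ω, (S.Y s ω : ℝ) ∂S.P) + ∫ ω, S.J s t ω ∂S.P) := by
  have hst : s ≤ t := by linarith
  have ht0 : 0 ≤ t := hs.trans hst
  set C1 := C * (10 + ρ + 3 * n) with hC1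
  have hC10 : 0 ≤ C1 := by positivity
  let G : ℕ → ℝ → ℝ := fun k a => if k ≤ n then v (k+1) a - v k a else 0
  let D : S.Ω → ℝ := fun ω => G (S.Y s ω) (S.A s ω)
  have hDm : AEStronglyMeasurable[S.ℱ s] D S.P := S.G_aesm hs G (fun k => by
    by_cases hk : k ≤ n
    · simp only [G, hk, if_true]; exact (hvm (k+1)).sub (hvm k)
    · simp [G, hk])
  have hDb : ∀ ω, |D ω| ≤ 2 * C := by
    intro ω
    have h0 := S.A_nonneg ω hs
    have h1 := S.A_le ω hs
    have h2 := hvb _ _ h0 h1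
    have h3 := hvb (S.Y s ω + 1) _ h0 (by push_cast; linarith)
    simp only [D, G]
    split_ifs
    · rw [abs_le] at *; constructor <;> linarith
    · simp; linarith
  obtain ⟨hMi, hM0⟩ := S.mart_zero hs hst D hDm _ hDb
  have hZt := S.Z_int n v C hC hvm hvb ht0
  have hZs := S.Z_int n v C hC hvm hvb hs
  have hpt : ∀ ω, Real.exp (-ρ * δ) * (if S.Y t ω ≤ n then v (S.Y t ω) (S.A t ω) else 0)
      + κ * (S.cross n s t).indicator (fun _ => (1:ℝ)) ω ≤
      ((if S.Y s ω ≤ n then v (S.Y s ω) (S.A s ω) else 0)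
      + D ω * (((S.Y t ω : ℝ) - S.Y s ω) - (S.A t ω - S.A s ω)))
      + (C1 * (δ ^ 2 + δ * ((S.Y t ω : ℝ) - S.Y s ω) + S.J s t ω)) := by
    intro ω
    have hY := S.Y_mono ω hs hst
    have hYr : (S.Y s ω : ℝ) ≤ S.Y t ω := by exact_mod_cast hY
    by_cases hk : S.Y s ω ≤ n
    · obtain ⟨j, hj⟩ := Nat.exists_eq_add_of_le hY
      have hts : t - s = δ := by linarith
      have h := step_det ρ hρ n v C κ hC hvκ hvb hvL hvs (S.Y s ω) j (S.A s ω) (S.A t ω) δ hk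
        (S.A_nonneg ω hs) (S.A_le ω hs) (S.A_mono ω hs hst) (by rw [← hj]; exact S.A_le ω ht0) hδ hδ1
        (by rw [← hj, ← hts]; exact S.A_upper ω hs hst)
        (by
          intro hj0
          rw [← hts]
          exact S.A_lower ω hs hst (by rw [hj, hj0, add_zero]))
      have hJ : S.J s t ω = if 2 ≤ j then (j:ℝ) else 0 := by
        have : S.Y t ω - S.Y s ω = j := by omega
        rw [J, this]
      have hjr : (j:ℝ) = (S.Y t ω : ℝ) - S.Y s ω := by rw [hj]; push_cast; ring
      rw [← hJ, ← hj, hjr] at h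
      rw [if_pos hk]
      have hD' : D ω = v (S.Y s ω + 1) (S.A s ω) - v (S.Y s ω) (S.A s ω) := by simp [D, G, hk]
      rw [hD']
      refine le_trans (le_of_eq ?_) h
      by_cases hn : S.Y t ω ≤ n
      · have : ω ∉ S.cross n s t := fun hh => absurd hh.2 (not_lt.2 hn)
        simp [hn, this]
      · have : ω ∈ S.cross n s t := ⟨hk, not_le.1 hn⟩
        simp [hn, this]
    · have h1 : ω ∉ S.cross n s t := fun hh => hk hh.1
      have h2 : ¬ S.Y t ω ≤ n := by omega
      have hD' : D ω = 0 := by simp [D, G, hk]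
      simp only [h1, h2, hk, hD', if_false, not_false_eq_true, Set.indicator_of_notMem]
      have := S.J_nonneg s t ω
      have h3 : 0 ≤ δ * ((S.Y t ω : ℝ) - S.Y s ω) := mul_nonneg hδ (by linarith)
      have : 0 ≤ C1 * (δ ^ 2 + δ * ((S.Y t ω : ℝ) - S.Y s ω) + S.J s t ω) := by positivity
      linarith
  have hci : Integrable ((S.cross n s t).indicator (fun _ => (1:ℝ))) S.P :=
    (integrable_const 1).indicator (S.cross_meas n s t)
  have hYi := (S.integrableY t).sub (S.integrableY s)
  have hYi' : Integrable (fun ω => (S.Y t ω : ℝ) - S.Y s ω) S.P := hYi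
  have hJi := S.J_int hs hst
  have i1 : Integrable (fun ω => δ ^ 2 + δ * ((S.Y t ω : ℝ) - S.Y s ω)) S.P :=
    (integrable_const _).add (hYi'.const_mul δ)
  have i2 : Integrable (fun ω => δ ^ 2 + δ * ((S.Y t ω : ℝ) - S.Y s ω) + S.J s t ω) S.P :=
    i1.add hJi
  have i0 : Integrable (fun ω => (if S.Y s ω ≤ n then v (S.Y s ω) (S.A s ω) else 0)
      + D ω * (((S.Y t ω : ℝ) - S.Y s ω) - (S.A t ω - S.A s ω))) S.P := hZs.add hMi
  have h := integral_mono ((hZt.const_mul (Real.exp (-ρ * δ))).add (hci.const_mul κ))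
    (i0.add (i2.const_mul C1)) hpt
  simp only [Pi.add_apply] at h
  rw [integral_add (hZt.const_mul (Real.exp (-ρ * δ))) (hci.const_mul κ), integral_const_mul,
    integral_const_mul, integral_indicator_const _ (S.cross_meas n s t),
    integral_add i0 (i2.const_mul C1), integral_const_mul, integral_add i1 hJi,
    integral_add (integrable_const _) (hYi'.const_mul δ), integral_const_mul,
    integral_sub (S.integrableY t) (S.integrableY s), integral_add hZs hMi, hM0] at h
  simpa [Z] using h

end YuleSimonSetup

open MeasureTheory ProbabilityTheory

namespace YuleSimonSetup

variable {ρ : ℝ}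

lemma sum_exp (S : YuleSimonSetup 1 ρ) (hρ : 0 < ρ) (n : ℕ) (v : ℕ → ℝ → ℝ) (C κ : ℝ) (hC : 0 ≤ C)
    (hvm : ∀ k, Measurable (v k))
    (hvκ : ∀ k, n < k → ∀ a, v k a = κ)
    (hvb : ∀ (k : ℕ) (a : ℝ), 0 ≤ a → a ≤ k → |v k a| ≤ C)
    (hvL : ∀ (k : ℕ) (a b : ℝ), 0 ≤ a → a ≤ k → 0 ≤ b → b ≤ k → |v k a - v k b| ≤ C * |a - b|)
    (hvs : ∀ (k : ℕ) (a δ : ℝ), k ≤ n → 0 ≤ a → a ≤ k → 0 ≤ δ → δ ≤ 1 →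
      Real.exp (-ρ * δ) * v k (a + (k - a) * δ) - v k a + (v (k+1) a - v k a) * ((k - a) * δ)
        ≤ C * δ ^ 2)
    {δ : ℝ} (hδ : 0 ≤ δ) (hδ1 : δ ≤ 1) (m : ℕ) :
    Real.exp (-ρ * (m * δ)) * S.Z n v (m * δ)
      + κ * ∑ i ∈ Finset.range m, Real.exp (-ρ * (i * δ)) *
          S.P.real (S.cross n (i * δ) ((i + 1 : ℕ) * δ)) ≤
      S.Z n v 0 + C * (10 + ρ + 3 * n) *
        (m * δ ^ 2 + δ * ((∫ ω, (S.Y (m * δ) ω : ℝ) ∂S.P) - ∫ ω, (S.Y 0 ω : ℝ) ∂S.P)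
          + ∑ i ∈ Finset.range m, ∫ ω, S.J (i * δ) ((i + 1 : ℕ) * δ) ω ∂S.P) := by
  induction m with
  | zero => simp
  | succ m ih =>
    have hs : 0 ≤ m * δ := by positivity
    have h := S.step_exp hρ n v C κ hC hvm hvκ hvb hvL hvs hs hδ hδ1
      (show ((m+1:ℕ):ℝ) * δ = m * δ + δ by push_cast; ring)
    rw [Finset.sum_range_succ, Finset.sum_range_succ]
    set C1 := C * (10 + ρ + 3 * n) with hC1
    have hC10 : 0 ≤ C1 := by positivity
    have he : Real.exp (-ρ * ((m+1:ℕ) * δ)) = Real.exp (-ρ * (m * δ)) * Real.exp (-ρ * δ) := by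
      rw [← Real.exp_add]; congr 1; push_cast; ring
    have he0 := Real.exp_pos (-ρ * (m * δ))
    have he1 : Real.exp (-ρ * (m * δ)) ≤ 1 := Real.exp_le_one_iff.2 (by nlinarith)
    have hmono : ∫ ω, (S.Y (m * δ) ω : ℝ) ∂S.P ≤ ∫ ω, (S.Y ((m+1:ℕ) * δ) ω : ℝ) ∂S.P := by
      apply integral_mono (S.integrableY _) (S.integrableY _)
      intro ω
      simp only [Nat.cast_le]
      exact S.Y_mono ω hs (by push_cast; nlinarith)
    have hJ : 0 ≤ ∫ ω, S.J (m * δ) ((m + 1 : ℕ) * δ) ω ∂S.P :=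
      integral_nonneg (S.J_nonneg _ _)
    rw [he]
    have h2 := mul_le_mul_of_nonneg_left h he0.le
    set E := C1 * (δ ^ 2 + δ * ((∫ ω, (S.Y ((m+1:ℕ) * δ) ω : ℝ) ∂S.P) - ∫ ω, (S.Y (m * δ) ω : ℝ) ∂S.P)
       + ∫ ω, S.J (m * δ) ((m+1:ℕ) * δ) ω ∂S.P) with hE
    have hE0 : 0 ≤ E := by
      have : 0 ≤ δ * ((∫ ω, (S.Y ((m+1:ℕ) * δ) ω : ℝ) ∂S.P) - ∫ ω, (S.Y (m * δ) ω : ℝ) ∂S.P) :=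
        mul_nonneg hδ (by linarith)
      positivity
    have h3 : Real.exp (-ρ * (m * δ)) * E ≤ E := by nlinarith
    push_cast at *
    nlinarith

lemma J_sum_tendsto (S : YuleSimonSetup 1 ρ) {t : ℝ} (ht : 0 < t) :
    Filter.Tendsto (fun m : ℕ => ∑ i ∈ Finset.range m,
      ∫ ω, S.J (i * (t / m)) ((i + 1 : ℕ) * (t / m)) ω ∂S.P) Filter.atTop (nhds 0) := by
  have hgrid : ∀ (m i : ℕ), 0 ≤ (i:ℝ) * (t / m) ∧ (i:ℝ) * (t / m) ≤ ((i+1:ℕ):ℝ) * (t / m) := by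
    intro m i
    have : 0 ≤ t / m := by positivity
    constructor
    · positivity
    · push_cast; nlinarith
  have hsum : ∀ m : ℕ, ∑ i ∈ Finset.range m, ∫ ω, S.J (i * (t / m)) ((i + 1 : ℕ) * (t / m)) ω ∂S.P
      = ∫ ω, ∑ i ∈ Finset.range m, S.J (i * (t / m)) ((i + 1 : ℕ) * (t / m)) ω ∂S.P := by
    intro m
    rw [integral_finset_sum]
    intro i _
    exact S.J_int (hgrid m i).1 (hgrid m i).2
  simp_rw [hsum]
  rw [show (0:ℝ) = ∫ ω, (0:ℝ) ∂S.P by simp]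
  apply tendsto_integral_of_dominated_convergence (fun ω => (S.Y t ω : ℝ))
  · intro m
    exact (Finset.measurable_sum _ fun i _ => S.J_meas _ _).aestronglyMeasurable
  · exact S.integrableY t
  · intro m
    refine Filter.Eventually.of_forall fun ω => ?_
    rw [Real.norm_eq_abs, abs_of_nonneg (Finset.sum_nonneg fun i _ => S.J_nonneg _ _ ω)]
    calc _ ≤ ∑ i ∈ Finset.range m, ((S.Y ((i + 1 : ℕ) * (t / m)) ω : ℝ) - S.Y (i * (t / m)) ω) :=
          Finset.sum_le_sum fun i _ => S.J_le (hgrid m i).1 (hgrid m i).2 ω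
      _ = (S.Y (m * (t / m)) ω : ℝ) - S.Y ((0:ℕ) * (t / m)) ω :=
          Finset.sum_range_sub (fun i : ℕ => (S.Y (i * (t / m)) ω : ℝ)) m
      _ ≤ S.Y (m * (t / m)) ω := by simp
      _ ≤ S.Y t ω := by
          have : (m:ℝ) * (t / m) ≤ t := by
            rcases Nat.eq_zero_or_pos m with rfl | hm
            · simp; exact ht.le
            · field_simp; exact le_rfl
          exact_mod_cast S.Y_mono ω (by positivity) this
  · refine Filter.Eventually.of_forall fun ω => ?_
    -- a uniform gap
    have hgap : ∀ k : ℕ, ∃ ε > (0:ℝ), 1 ≤ k → k ≤ S.Y t ω →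
        ∃ s, 0 ≤ s ∧ S.Y s ω = k ∧ ∀ r ∈ Set.Ico s (s + ε), S.Y r ω = k := by
      intro k
      by_cases hk : 1 ≤ k ∧ k ≤ S.Y t ω
      · obtain ⟨s, hs, hsk⟩ := S.unitJumps ω t ht.le k hk.1 hk.2
        obtain ⟨ε, hε, h⟩ := S.rightCont ω s hs.1
        exact ⟨ε, hε, fun _ _ => ⟨s, hs.1, hsk, fun r hr => by rw [h r hr, hsk]⟩⟩
      · exact ⟨1, one_pos, fun h1 h2 => absurd ⟨h1, h2⟩ hk⟩
    choose ε hε hgap using hgap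
    have hev : ∀ᶠ m : ℕ in Filter.atTop, ∀ k ∈ Finset.range (S.Y t ω + 1), t / m < ε k := by
      rw [Filter.eventually_all_finset]
      intro k _
      have : Filter.Tendsto (fun m : ℕ => t / (m:ℝ)) Filter.atTop (nhds 0) :=
        tendsto_const_div_atTop_nhds_zero_nat t
      exact this.eventually (gt_mem_nhds (hε k))
    refine Filter.Tendsto.congr' ?_ tendsto_const_nhds
    filter_upwards [hev, Filter.eventually_gt_atTop 0] with m hm hm0
    symm
    apply Finset.sum_eq_zero
    intro i hi
    unfold J
    rw [if_neg]
    intro h2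
    have hi' : i + 1 ≤ m := Finset.mem_range.1 hi
    have hle : ((i+1:ℕ):ℝ) * (t / m) ≤ t := by
      have : ((i+1:ℕ):ℝ) ≤ m := by exact_mod_cast hi'
      have hm0' : (0:ℝ) < m := by exact_mod_cast hm0
      rw [mul_div_assoc', div_le_iff₀ hm0']
      nlinarith
    have g0 := (hgrid m i).1
    have g1 := (hgrid m i).2
    have hYt := S.Y_mono ω (g0.trans g1) hle
    set k := S.Y (i * (t / m)) ω + 1 with hk
    obtain ⟨s, hs0, hsk, hs⟩ := hgap k (by omega) (by omega)
    have hlt := hm k (by rw [Finset.mem_range]; omega)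
    have hs1 : (i:ℝ) * (t / m) < s := by
      by_contra hcon
      have := S.Y_mono ω hs0 (not_lt.1 hcon)
      omega
    have hs2 : s + ε k ≤ ((i+1:ℕ):ℝ) * (t / m) := by
      by_contra hcon
      push Not at hcon
      rcases le_total s (((i+1:ℕ):ℝ) * (t / m)) with h | h
      · have := hs _ ⟨h, hcon⟩
        omega
      · have := S.Y_mono ω (g0.trans g1) h
        omega
    push_cast at hs2
    nlinarith

lemma T_gt (S : YuleSimonSetup 1 ρ) (hρ : 0 < ρ) {s : ℝ} (hs : 0 ≤ s) :
    S.P.real {ω | s < S.T ω} = Real.exp (-ρ * s) := by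
  have h1 : {ω | s < S.T ω} = {ω | S.T ω ≤ s}ᶜ := by ext ω; simp
  have h2 : MeasurableSet {ω | S.T ω ≤ s} := measurableSet_le S.measT measurable_const
  rw [h1, probReal_compl_eq_one_sub h2, Measure.real, S.lawT s hs, ENNReal.toReal_ofReal]
  · ring
  · have : Real.exp (-ρ * s) ≤ 1 := Real.exp_le_one_iff.2 (by nlinarith)
    linarith

lemma T_indep (S : YuleSimonSetup 1 ρ) (hρ : 0 < ρ) (n : ℕ) {r : ℝ} (hr : 0 ≤ r) (s t : ℝ) :
    S.P.real (S.cross n s t ∩ {ω | r < S.T ω}) = Real.exp (-ρ * r) * S.P.real (S.cross n s t) := by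
  have h := S.indepT.measure_inter_preimage_eq_mul (Set.Ioi r) {f : ℝ → ℕ | f s ≤ n ∧ n < f t}
    measurableSet_Ioi
    ((measurableSet_le (measurable_pi_apply s) measurable_const).inter
      (measurableSet_lt measurable_const (measurable_pi_apply t)))
  have h' : S.P ({ω | r < S.T ω} ∩ S.cross n s t) = S.P {ω | r < S.T ω} * S.P (S.cross n s t) := h
  rw [Set.inter_comm, Measure.real, h', ENNReal.toReal_mul, ← S.T_gt hρ hr]
  rfl

lemma T_pos (S : YuleSimonSetup 1 ρ) : S.P.real {ω | S.T ω ≤ 0} = 0 := by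
  rw [Measure.real, S.lawT 0 le_rfl]; simp

lemma tail_upper (S : YuleSimonSetup 1 ρ) (hρ : 0 < ρ) (n : ℕ) (hn : 1 ≤ n) {δ : ℝ} (hδ : 0 ≤ δ)
    (m : ℕ) :
    (S.tail n).toReal ≤ (∑ i ∈ Finset.range m, Real.exp (-ρ * (i * δ)) *
          S.P.real (S.cross n (i * δ) ((i + 1 : ℕ) * δ))) + Real.exp (-ρ * (m * δ)) := by
  have hsub : {ω | n < S.Y (S.T ω) ω} ⊆
      ((⋃ i ∈ Finset.range m, S.cross n (i * δ) ((i + 1 : ℕ) * δ) ∩ {ω | i * δ < S.T ω}) ∪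
      {ω | m * δ < S.T ω}) ∪ {ω | S.T ω ≤ 0} := by
    intro ω hω
    simp only [Set.mem_setOf_eq] at hω
    by_cases h0 : S.T ω ≤ 0
    · exact Or.inr h0
    by_cases h1 : m * δ < S.T ω
    · exact Or.inl (Or.inr h1)
    push Not at h0 h1
    refine Or.inl (Or.inl ?_)
    have hm : n < S.Y (m * δ) ω := hω.trans_le (S.Y_mono ω h0.le h1)
    have hex : ∃ i : ℕ, n < S.Y (i * δ) ω := ⟨m, hm⟩
    classical
    have hf := Nat.find_spec hex
    have hmin := fun j => Nat.find_min hex (m := j)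
    have hle : Nat.find hex ≤ m := Nat.find_min' hex hm
    rcases hN : Nat.find hex with _ | j
    · rw [hN] at hf
      simp [S.Y0] at hf
      omega
    · rw [hN] at hf hmin hle
      have hj := hmin j (Nat.lt_succ_self j)
      simp only [Set.mem_iUnion]
      refine ⟨j, Finset.mem_range.2 hle, ⟨not_lt.1 hj, hf⟩, ?_⟩
      by_contra hcon
      simp only [Set.mem_setOf_eq, not_lt] at hcon
      have := S.Y_mono ω h0.le hcon
      omega
  have h1 : (S.tail n).toReal ≤ _ := measureReal_mono (μ := S.P) hsub
  refine h1.trans ((measureReal_union_le _ _).trans ?_)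
  rw [S.T_pos, add_zero]
  refine (measureReal_union_le _ _).trans ?_
  rw [S.T_gt hρ (by positivity)]
  gcongr
  refine (measureReal_biUnion_finset_le _ _).trans (Finset.sum_le_sum fun i _ => ?_)
  rw [S.T_indep hρ n (by positivity)]

lemma tail_lower (S : YuleSimonSetup 1 ρ) (hρ : 0 < ρ) (n : ℕ) {δ : ℝ} (hδ : 0 ≤ δ)
    (m : ℕ) :
    Real.exp (-ρ * δ) * (∑ i ∈ Finset.range m, Real.exp (-ρ * (i * δ)) *
          S.P.real (S.cross n (i * δ) ((i + 1 : ℕ) * δ))) ≤ (S.tail n).toReal := by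
  have hTm : ∀ r : ℝ, MeasurableSet {ω | r < S.T ω} := fun r =>
    measurableSet_lt measurable_const S.measT
  have hle : ∀ i j : ℕ, i ≤ j → (i:ℝ) * δ ≤ j * δ := fun i j h => by
    have : (i:ℝ) ≤ j := by exact_mod_cast h
    gcongr
  have hsub : (⋃ i ∈ Finset.range m, S.cross n (i * δ) ((i + 1 : ℕ) * δ) ∩
      {ω | ((i + 1 : ℕ):ℝ) * δ < S.T ω}) ⊆ {ω | n < S.Y (S.T ω) ω} := by
    intro ω hω
    simp only [Set.mem_iUnion] at hω
    obtain ⟨i, _, hc, hT⟩ := hω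
    exact hc.2.trans_le (S.Y_mono ω (by positivity) (le_of_lt hT))
  have h1 : _ ≤ (S.tail n).toReal := measureReal_mono (μ := S.P) hsub
  refine le_trans (le_of_eq ?_) h1
  rw [measureReal_biUnion_finset]
  · rw [Finset.mul_sum]
    refine Finset.sum_congr rfl fun i _ => ?_
    rw [S.T_indep hρ n (by positivity), ← mul_assoc, ← Real.exp_add]
    congr 2; push_cast; ring
  · have key : ∀ i j : ℕ, i < j → Disjoint (S.cross n (i * δ) ((i + 1 : ℕ) * δ) ∩
      {ω | ((i + 1 : ℕ):ℝ) * δ < S.T ω}) (S.cross n (j * δ) ((j + 1 : ℕ) * δ) ∩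
      {ω | ((j + 1 : ℕ):ℝ) * δ < S.T ω}) := by
      intro i j hij
      rw [Set.disjoint_left]
      intro ω h1 h2
      have := S.Y_mono ω (by positivity) (hle (i+1) j hij)
      have h3 := h1.1.2
      have h4 := h2.1.1
      omega
    intro i _ j _ hij
    rcases lt_or_gt_of_ne hij with h | h
    · exact key i j h
    · exact (key j i h).symm
  · intro i _
    exact (S.cross_meas _ _ _).inter (hTm _)

lemma tail_le_one (S : YuleSimonSetup 1 ρ) (n : ℕ) : (S.tail n).toReal ≤ 1 :=
  measureReal_le_one (μ := S.P)

lemma dynkin0 (S : YuleSimonSetup 1 ρ) (hρ : 0 < ρ) (n : ℕ) (hn : 1 ≤ n)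
    (v : ℕ → ℝ → ℝ) (C κ : ℝ) (hC : 0 ≤ C)
    (hvm : ∀ k, Measurable (v k))
    (hvκ : ∀ k, n < k → ∀ a, v k a = κ)
    (hvb : ∀ (k : ℕ) (a : ℝ), 0 ≤ a → a ≤ k → |v k a| ≤ C)
    (hvL : ∀ (k : ℕ) (a b : ℝ), 0 ≤ a → a ≤ k → 0 ≤ b → b ≤ k → |v k a - v k b| ≤ C * |a - b|)
    (hvs : ∀ (k : ℕ) (a δ : ℝ), k ≤ n → 0 ≤ a → a ≤ k → 0 ≤ δ → δ ≤ 1 →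
      Real.exp (-ρ * δ) * v k (a + (k - a) * δ) - v k a + (v (k+1) a - v k a) * ((k - a) * δ)
        ≤ C * δ ^ 2) :
    κ * (S.tail n).toReal ≤ v 1 0 := by
  have hZ0 : S.Z n v 0 = v 1 0 := by
    simp [Z, S.Y0, hn, A]
  have hZb : ∀ t, 0 ≤ t → -C ≤ S.Z n v t := by
    intro t ht
    have : ‖S.Z n v t‖ ≤ C * S.P.real Set.univ := by
      unfold Z
      apply norm_integral_le_of_norm_le_const
      refine Filter.Eventually.of_forall fun ω => ?_
      rw [Real.norm_eq_abs]
      split_ifs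
      · exact hvb _ _ (S.A_nonneg ω ht) (S.A_le ω ht)
      · simpa using hC
    simp at this
    exact (abs_le.1 this).1
  have hE : ∀ t : ℝ, 0 < t → κ * (S.tail n).toReal ≤ v 1 0 + (|κ| + C) * Real.exp (-ρ * t) := by
    intro t ht
    set C1 := C * (10 + ρ + 3 * n) with hC1
    have hδ : Filter.Tendsto (fun m : ℕ => t / (m:ℝ)) Filter.atTop (nhds 0) :=
        tendsto_const_div_atTop_nhds_zero_nat t
    have hlim : Filter.Tendsto (fun m : ℕ => v 1 0 + C1 * (t * (t / m) + (t / m) *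
        ((∫ ω, (S.Y t ω : ℝ) ∂S.P) - ∫ ω, (S.Y 0 ω : ℝ) ∂S.P)
          + ∑ i ∈ Finset.range m, ∫ ω, S.J (i * (t/m)) ((i + 1 : ℕ) * (t/m)) ω ∂S.P)
          + C * Real.exp (-ρ * t) + |κ| * (Real.exp (-ρ * t) + (Real.exp (ρ * (t / m)) - 1)))
        Filter.atTop (nhds (v 1 0 + C1 * (t * 0 + 0 *
        ((∫ ω, (S.Y t ω : ℝ) ∂S.P) - ∫ ω, (S.Y 0 ω : ℝ) ∂S.P)
          + 0)
          + C * Real.exp (-ρ * t) + |κ| * (Real.exp (-ρ * t) + (Real.exp (ρ * 0) - 1)))) := by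
      have he : Filter.Tendsto (fun m : ℕ => Real.exp (ρ * (t / m))) Filter.atTop
          (nhds (Real.exp (ρ * 0))) := (Real.continuous_exp.tendsto _).comp (hδ.const_mul ρ)
      have hJ := S.J_sum_tendsto ht
      exact (((((hδ.const_mul t).add (hδ.mul_const _)).add hJ).const_mul C1).const_add _
        |>.add_const _).add (((he.sub_const 1).const_add _).const_mul _)
    have h := ge_of_tendsto hlim (b := κ * (S.tail n).toReal) (by
      filter_upwards [hδ.eventually (gt_mem_nhds one_pos), Filter.eventually_gt_atTop 0] with m h1 hm
      have hm0 : (0:ℝ) < m := by exact_mod_cast hm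
      have hδ0 : 0 ≤ t / m := by positivity
      have hmt : (m:ℝ) * (t / m) = t := by field_simp
      have hs := S.sum_exp hρ n v C κ hC hvm hvκ hvb hvL hvs hδ0 h1.le m
      have hu := S.tail_upper hρ n hn hδ0 m
      have hl := S.tail_lower hρ n hδ0 m
      set Q := ∑ i ∈ Finset.range m, Real.exp (-ρ * (i * (t/m))) *
          S.P.real (S.cross n (i * (t/m)) ((i + 1 : ℕ) * (t/m))) with hQ
      rw [hmt] at hs hu
      rw [hZ0] at hs
      have hZ := hZb t ht.le
      have he0 := Real.exp_pos (-ρ * t)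
      have hQ2 : Q ≤ (S.tail n).toReal + (Real.exp (ρ * (t / m)) - 1) := by
        have e1 : Real.exp (ρ * (t/m)) * Real.exp (-ρ * (t/m)) = 1 := by
          rw [← Real.exp_add]; simp
        have e2 : 1 ≤ Real.exp (ρ * (t/m)) := Real.one_le_exp (by positivity)
        have h3 := mul_le_mul_of_nonneg_left hl (Real.exp_pos (ρ * (t/m))).le
        rw [← mul_assoc, e1, one_mul] at h3
        have := S.tail_le_one n
        nlinarith
      have hkap : κ * ((S.tail n).toReal - Q) ≤
          |κ| * (Real.exp (-ρ * t) + (Real.exp (ρ * (t / m)) - 1)) := by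
        refine (le_abs_self _).trans ?_
        rw [abs_mul]
        gcongr
        have e2 : 1 ≤ Real.exp (ρ * (t/m)) := Real.one_le_exp (by positivity)
        rw [abs_le]; constructor <;> linarith
      have hms : (m:ℝ) * (t/m)^2 = t * (t/m) := by rw [sq, ← mul_assoc, hmt]
      rw [hms] at hs
      nlinarith)
    simp at h
    simp only [neg_mul] at *
    linarith
  have hlim : Filter.Tendsto (fun t : ℝ => v 1 0 + (|κ| + C) * Real.exp (-ρ * t)) Filter.atTop
      (nhds (v 1 0 + (|κ| + C) * 0)) := by
    apply Filter.Tendsto.const_add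
    apply Filter.Tendsto.const_mul
    apply Real.tendsto_exp_atBot.comp
    exact Filter.tendsto_id.const_mul_atTop_of_neg (by linarith)
  have := ge_of_tendsto hlim (b := κ * (S.tail n).toReal)
    ((Filter.eventually_gt_atTop 0).mono hE)
  simpa using this

/-- verification theorem -/
lemma dynkin (S : YuleSimonSetup 1 ρ) (hρ : 0 < ρ) (n : ℕ) (hn : 1 ≤ n)
    (u : ℕ → ℝ → ℝ) (C κ : ℝ) (hC : 0 ≤ C)
    (hum : ∀ k, Measurable (u k))
    (hub : ∀ (k : ℕ) (a : ℝ), k ≤ n → 0 ≤ a → a ≤ k → |u k a| ≤ C)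
    (huL : ∀ (k : ℕ) (a b : ℝ), k ≤ n → 0 ≤ a → a ≤ k → 0 ≤ b → b ≤ k →
      |u k a - u k b| ≤ C * |a - b|)
    (huκ : ∀ a : ℝ, 0 ≤ a → a ≤ (n+1:ℕ) → κ ≤ u (n+1) a)
    (hus : ∀ (k : ℕ) (a δ : ℝ), k ≤ n → 0 ≤ a → a ≤ k → 0 ≤ δ → δ ≤ 1 →
      Real.exp (-ρ * δ) * u k (a + (k - a) * δ) - u k a + (u (k+1) a - u k a) * ((k - a) * δ)
        ≤ C * δ ^ 2) :
    κ * (S.tail n).toReal ≤ u 1 0 := by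
  have := S.dynkin0 hρ n hn (fun k a => if k ≤ n then u k a else κ) (C + |κ|) κ (by positivity)
    (by
      intro k
      by_cases hk : k ≤ n
      · simpa [hk] using hum k
      · simp [hk])
    (by intro k hk a; simp [not_le.2 hk])
    (by
      intro k a h0 h1
      have := abs_nonneg κ
      split_ifs with hk
      · have := hub k a hk h0 h1
        linarith
      · linarith)
    (by
      intro k a b h0 h1 h2 h3
      split_ifs with hk
      · refine (huL k a b hk h0 h1 h2 h3).trans ?_
        gcongr
        linarith [abs_nonneg κ]
      · simp; positivity)
    (by
      intro k a δ hk h0 h1 h2 h3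
      rw [if_pos hk, if_pos hk]
      have h := hus k a δ hk h0 h1 h2 h3
      have h4 : C * δ ^ 2 ≤ (C + |κ|) * δ ^ 2 := by gcongr; linarith [abs_nonneg κ]
      have h5 : (if k + 1 ≤ n then u (k+1) a else κ) ≤ u (k+1) a := by
        split_ifs with hk1
        · exact le_rfl
        · obtain rfl : k = n := by omega
          exact huκ a h0 (by push_cast; linarith)
      have h6 : 0 ≤ ((k:ℝ) - a) * δ := mul_nonneg (by linarith) h2
      have h7 := mul_le_mul_of_nonneg_right (sub_le_sub_right h5 (u k a)) h6
      linarith)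
  simpa [hn] using this

end YuleSimonSetup

namespace YSAux

lemma exp_lip {s t B : ℝ} (hs : s ≤ B) (ht : t ≤ B) :
    |Real.exp s - Real.exp t| ≤ Real.exp B * |s - t| := by
  wlog h : s ≤ t generalizing s t
  · rw [abs_sub_comm, abs_sub_comm s t]
    exact this ht hs (by linarith)
  have h1 : Real.exp s ≤ Real.exp t := Real.exp_le_exp.2 h
  rw [abs_sub_comm, abs_sub_comm s t, abs_of_nonneg (by linarith), abs_of_nonneg (by linarith)]
  have h2 : Real.exp s = Real.exp t * Real.exp (s - t) := by rw [← Real.exp_add]; ring_nf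
  have h3 := Real.add_one_le_exp (s - t)
  have h4 : Real.exp t ≤ Real.exp B := Real.exp_le_exp.2 ht
  have h5 := Real.exp_pos t
  calc Real.exp t - Real.exp s = Real.exp t * (1 - Real.exp (s - t)) := by rw [h2]; ring
    _ ≤ Real.exp t * (t - s) := mul_le_mul_of_nonneg_left (by linarith) h5.le
    _ ≤ Real.exp B * (t - s) := mul_le_mul_of_nonneg_right h4 (by linarith)

/-- exponential test function -/
noncomputable def zf (q r m : ℝ) (k : ℕ) (a : ℝ) : ℝ := Real.exp (q * k - r * a - m)

lemma zf_pos (q r m : ℝ) (k : ℕ) (a : ℝ) : 0 < zf q r m k a := Real.exp_pos _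

lemma zf_le {q r m : ℝ} (hq : 0 ≤ q) (hr : 0 ≤ r) {k n : ℕ} (hk : k ≤ n) {a : ℝ} (ha : 0 ≤ a) :
    zf q r m k a ≤ Real.exp (q * n - m) := by
  unfold zf
  have hk' : (k:ℝ) ≤ n := by exact_mod_cast hk
  have := mul_le_mul_of_nonneg_left hk' hq
  have := mul_nonneg hr ha
  exact Real.exp_le_exp.2 (by linarith)

lemma zf_lip {q r m : ℝ} (hq : 0 ≤ q) (hr : 0 ≤ r) {k n : ℕ} (hk : k ≤ n) {a b : ℝ}
    (ha : 0 ≤ a) (hb : 0 ≤ b) :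
    |zf q r m k a - zf q r m k b| ≤ Real.exp (q * n - m) * r * |a - b| := by
  unfold zf
  have hk' : (k:ℝ) ≤ n := by exact_mod_cast hk
  have := mul_le_mul_of_nonneg_left hk' hq
  have := mul_nonneg hr ha
  have := mul_nonneg hr hb
  refine (exp_lip (B := q * n - m) (by linarith) (by linarith)).trans (le_of_eq ?_)
  rw [show q * k - r * a - m - (q * k - r * b - m) = r * (b - a) by ring, abs_mul,
    abs_of_nonneg hr, abs_sub_comm b a]
  ring

lemma zf_meas (q r m : ℝ) (k : ℕ) : Measurable (zf q r m k) := by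
  unfold zf
  fun_prop

lemma exp_neg_le {x : ℝ} (hx : 0 ≤ x) : Real.exp (-x) ≤ 1 - x + x ^ 2 := by
  rw [Real.exp_neg]
  have h1 := Real.add_one_le_exp x
  have h2 : (Real.exp x)⁻¹ ≤ (x + 1)⁻¹ := by gcongr
  refine h2.trans ?_
  rw [inv_le_iff_one_le_mul₀ (by linarith)]
  nlinarith [pow_nonneg hx 3]

lemma zf_step {q r m ρ : ℝ} (hρ : 0 < ρ) (hq : 0 ≤ q) (hr : 0 ≤ r) {k n : ℕ} (hk : k ≤ n)
    {a δ : ℝ} (ha : 0 ≤ a) (hak : a ≤ k) (hδ : 0 ≤ δ) :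
    Real.exp (-ρ * δ) * zf q r m k (a + (k - a) * δ) - zf q r m k a
      + (zf q r m (k+1) a - zf q r m k a) * ((k - a) * δ)
    ≤ zf q r m k a * (((Real.exp q - 1 - r) * (k - a) - ρ) * δ)
      + Real.exp (q * n - m) * (r * n + ρ) ^ 2 * δ ^ 2 := by
  have hk' : (k:ℝ) ≤ n := by exact_mod_cast hk
  set ξ : ℝ := k - a with hξ
  have hξ0 : 0 ≤ ξ := by linarith
  have hz := zf_pos q r m k a
  have hzB := zf_le (m := m) hq hr hk ha
  have e1 : Real.exp (-ρ * δ) * zf q r m k (a + ξ * δ)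
      = zf q r m k a * Real.exp (-((r * ξ + ρ) * δ)) := by
    unfold zf
    rw [← Real.exp_add, ← Real.exp_add]
    congr 1; ring
  have e2 : zf q r m (k+1) a = zf q r m k a * Real.exp q := by
    unfold zf
    rw [← Real.exp_add]
    congr 1; push_cast; ring
  rw [e1, e2]
  have hx : 0 ≤ (r * ξ + ρ) * δ := by positivity
  have h1 := exp_neg_le hx
  have h2 : (r * ξ + ρ) ≤ r * n + ρ := by
    have := mul_le_mul_of_nonneg_left (show ξ ≤ n by linarith) hr
    linarith
  have h3 : (r * ξ + ρ) ^ 2 ≤ (r * n + ρ) ^ 2 := pow_le_pow_left₀ (by positivity) h2 2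
  have h4 : zf q r m k a * (r * ξ + ρ) ^ 2 ≤ Real.exp (q * n - m) * (r * n + ρ) ^ 2 := by gcongr
  have h5 := mul_le_mul_of_nonneg_right h4 (sq_nonneg δ)
  have h6 := mul_le_mul_of_nonneg_left h1 hz.le
  nlinarith

end YSAux

open YSAux in
lemma YuleSimonSetup.tail_ub {ρ : ℝ} (S : YuleSimonSetup 1 ρ) (hρ : 0 < ρ) (n : ℕ) (hn : 1 ≤ n)
    (q c K : ℝ) (hc : 0 ≤ c) (hcq : c ≤ q) (hK : 0 < K)
    (hq : (Real.exp q - 1 - q + c) * K ≤ ρ) :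
    (S.tail n).toReal ≤ Real.exp (q * (1 - K)) + Real.exp (q - c * (n + 1 - K)) := by
  have hq0 : 0 ≤ q := hc.trans hcq
  have hr : 0 ≤ q - c := by linarith
  set m1 := q * K with hm1
  set m2 := c * (n + 1 - K) with hm2
  set h : ℕ → ℝ → ℝ := fun k a => zf q q m1 k a + zf q (q - c) m2 k a with hh
  set B1 := Real.exp (q * n - m1) with hB1
  set B2 := Real.exp (q * n - m2) with hB2
  have hB1p : 0 < B1 := Real.exp_pos _
  have hB2p : 0 < B2 := Real.exp_pos _
  set C := 1 + (B1 * q + B2 * (q - c)) + (B1 * (q * n + ρ)^2 + B2 * ((q - c) * n + ρ)^2) with hCdef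
  have hpos : ∀ k a, 0 < h k a := fun k a => add_pos (zf_pos _ _ _ _ _) (zf_pos _ _ _ _ _)
  have n1 : 0 ≤ B1 * q + B2 * (q - c) := by positivity
  have n2 : 0 ≤ B1 * (q * n + ρ)^2 + B2 * ((q - c) * n + ρ)^2 := by positivity
  have key := S.dynkin hρ n hn (fun k a => min 1 (h k a)) C 1 (by positivity)
    (by
      intro k
      exact measurable_const.min ((zf_meas _ _ _ _).add (zf_meas _ _ _ _)))
    (by
      intro k a hk h0 h1
      rw [abs_of_nonneg (le_min zero_le_one (hpos k a).le)]
      exact (min_le_left _ _).trans (by linarith))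
    (by
      intro k a b hk h0 h1 h2 h3
      have i1 : |min 1 (h k a) - min 1 (h k b)| ≤ |h k a - h k b| := by
        have := abs_min_sub_min_le_max 1 (h k a) 1 (h k b)
        simpa using this
      refine i1.trans ?_
      have i2 := zf_lip (m := m1) hq0 hq0 hk h0 h2
      have i3 := zf_lip (m := m2) hq0 hr hk h0 h2
      have i4 : h k a - h k b = (zf q q m1 k a - zf q q m1 k b)
          + (zf q (q - c) m2 k a - zf q (q - c) m2 k b) := by simp only [hh]; ring
      rw [i4]
      refine (abs_add_le _ _).trans ((add_le_add i2 i3).trans ?_)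
      rw [← add_mul]
      gcongr
      linarith)
    (by
      intro a h0 h1
      refine le_min le_rfl ?_
      simp only [hh]
      by_cases hcase : K ≤ (n + 1 : ℕ) - a
      · have : 1 ≤ zf q q m1 (n+1) a := by
          unfold zf
          rw [hm1]
          apply Real.one_le_exp
          have := mul_le_mul_of_nonneg_left hcase hq0
          linarith
        linarith [zf_pos q (q - c) m2 (n+1) a]
      · have : 1 ≤ zf q (q - c) m2 (n+1) a := by
          unfold zf
          rw [hm2]
          apply Real.one_le_exp
          push Not at hcase
          push_cast at hcase h1 ⊢
          have i1 := mul_nonneg hc (show 0 ≤ a - (n + 1 - K) by linarith)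
          have i2 := mul_nonneg hq0 (show 0 ≤ (n:ℝ) + 1 - a by linarith)
          linarith
        linarith [zf_pos q q m1 (n+1) a])
    (by
      intro k a δ hk h0 h1 h2 h3
      have hξ : 0 ≤ ((k:ℝ) - a) * δ := mul_nonneg (by linarith) h2
      have hexp : Real.exp (-ρ * δ) ≤ 1 := by
        apply Real.exp_le_one_iff.2
        have := mul_nonneg hρ.le h2
        linarith
      have hexp0 := Real.exp_pos (-ρ * δ)
      have hC0 : 0 ≤ C * δ^2 := by positivity
      rcases le_or_gt 1 (h k a) with hge | hlt
      · rw [min_eq_left hge]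
        have i1 : Real.exp (-ρ * δ) * min 1 (h k (a + (k - a) * δ)) ≤ 1 * 1 := by
          apply mul_le_mul hexp (min_le_left _ _) (le_min zero_le_one (hpos _ _).le) zero_le_one
        have i2 : (min 1 (h (k+1) a) - 1) * ((k - a) * δ) ≤ 0 :=
          mul_nonpos_of_nonpos_of_nonneg (by linarith [min_le_left 1 (h (k+1) a)]) hξ
        linarith
      · rw [min_eq_right hlt.le]
        have hξK : (k:ℝ) - a ≤ K := by
          by_contra hcon
          push Not at hcon
          have : 1 ≤ zf q q m1 k a := by
            unfold zf
            rw [hm1]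
            apply Real.one_le_exp
            have := mul_le_mul_of_nonneg_left hcon.le hq0
            linarith
          have := zf_pos q (q - c) m2 k a
          simp only [hh] at hlt
          linarith
        have i1 : Real.exp (-ρ * δ) * min 1 (h k (a + (k - a) * δ))
            ≤ Real.exp (-ρ * δ) * h k (a + (k - a) * δ) := by
          gcongr; exact min_le_right _ _
        have i2 : (min 1 (h (k+1) a) - h k a) * ((k - a) * δ)
            ≤ (h (k+1) a - h k a) * ((k - a) * δ) := by
          gcongr; exact min_le_right _ _
        have j1 := zf_step (m := m1) hρ hq0 hq0 hk h0 h1 h2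
        have j2 := zf_step (m := m2) hρ hq0 hr hk h0 h1 h2
        have eq1 : 0 ≤ Real.exp q - 1 - q := by linarith [Real.add_one_le_exp q]
        have l1 : (Real.exp q - 1 - (q - c)) * (k - a) - ρ ≤ 0 := by
          have : (Real.exp q - 1 - q + c) * (k - a) ≤ (Real.exp q - 1 - q + c) * K := by
            gcongr
          linarith
        have l2 : (Real.exp q - 1 - q) * (k - a) - ρ ≤ 0 := by
          have := mul_nonneg hc (show 0 ≤ (k:ℝ) - a by linarith)
          linarith
        have l3 : zf q q m1 k a * (((Real.exp q - 1 - q) * (k - a) - ρ) * δ) ≤ 0 :=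
          mul_nonpos_of_nonneg_of_nonpos (zf_pos _ _ _ _ _).le
            (mul_nonpos_of_nonpos_of_nonneg l2 h2)
        have l4 : zf q (q - c) m2 k a * (((Real.exp q - 1 - (q - c)) * (k - a) - ρ) * δ) ≤ 0 :=
          mul_nonpos_of_nonneg_of_nonpos (zf_pos _ _ _ _ _).le
            (mul_nonpos_of_nonpos_of_nonneg l1 h2)
        have l5 : (B1 * (q * n + ρ)^2 + B2 * ((q - c) * n + ρ)^2) * δ^2 ≤ C * δ^2 := by
          gcongr; linarith
        simp only [hh] at i1 i2 ⊢
        linarith)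
  rw [one_mul] at key
  refine key.trans ((min_le_right _ _).trans (le_of_eq ?_))
  simp only [hh, zf, hm1, hm2]
  congr 2 <;> (push_cast; ring)

namespace YSAux

noncomputable def g (c ξ : ℝ) : ℝ := ξ * Real.exp (c * √(ξ + 1))

noncomputable def dg (c ξ : ℝ) : ℝ :=
  Real.exp (c * √(ξ + 1)) * (1 + c * (ξ / (2 * √(ξ + 1))))

lemma g_nonneg {c ξ : ℝ} (h : 0 ≤ ξ) : 0 ≤ g c ξ := mul_nonneg h (Real.exp_pos _).le

lemma g_mono {c ξ η : ℝ} (hc : 0 ≤ c) (h0 : 0 ≤ ξ) (h : ξ ≤ η) : g c ξ ≤ g c η := by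
  have := h0.trans h
  unfold g
  gcongr

lemma g_tangent {c ξ η : ℝ} (hc : 0 ≤ c) (h0 : 0 ≤ η) (h : η ≤ ξ) :
    g c ξ - dg c ξ * (ξ - η) ≤ g c η := by
  unfold g dg
  set r := √(ξ + 1) with hr
  set s := √(η + 1) with hs
  have hr2 : r ^ 2 = ξ + 1 := Real.sq_sqrt (by linarith)
  have hs2 : s ^ 2 = η + 1 := Real.sq_sqrt (by linarith)
  have hsr : s ≤ r := Real.sqrt_le_sqrt (by linarith)
  have hs1 : 1 ≤ s := Real.one_le_sqrt.2 (by linarith)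
  have hr1 : 1 ≤ r := hs1.trans hsr
  have e1 : Real.exp (c * s) = Real.exp (c * r) * Real.exp (c * (s - r)) := by
    rw [← Real.exp_add]; ring_nf
  have e2 := Real.add_one_le_exp (c * (s - r))
  have hE := Real.exp_pos (c * r)
  have hξ : ξ = r^2 - 1 := by linarith
  have hη : η = s^2 - 1 := by linarith
  have k1 : 2 * r * (s^2 - 1) ≤ (r^2 - 1) * (r + s) := by
    have : (s^2-1) * r ≤ (r^2-1) * s := by nlinarith [mul_nonneg (sub_nonneg.2 hsr) (show 0 ≤ r * s + 1 by positivity)]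
    have : (s^2-1) * r ≤ (r^2-1) * r := by gcongr
    linarith
  have k2 : (s^2 - 1) ≤ (r^2 - 1) / (2 * r) * (r + s) := by
    rw [div_mul_eq_mul_div, le_div_iff₀ (by positivity)]
    linarith
  have k3 := mul_le_mul_of_nonneg_left k2 (mul_nonneg hc (sub_nonneg.2 hsr))
  have k4 : ξ - (1 + c * (ξ / (2 * r))) * (ξ - η) ≤ η * (1 + c * (s - r)) := by
    rw [hξ, hη]
    nlinarith
  have k5 : η * (1 + c * (s - r)) ≤ η * Real.exp (c * (s - r)) := by
    gcongr; linarith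
  rw [e1]
  have := mul_le_mul_of_nonneg_left (k4.trans k5) hE.le
  nlinarith

lemma g_succ {c ξ ρ : ℝ} (hc : 0 ≤ c) (hcρ : c ^ 2 = 16 * ρ) (h0 : 0 ≤ ξ) :
    g c ξ + dg c ξ + ρ * Real.exp (c * √(ξ + 1)) ≤ g c (ξ + 1) := by
  unfold g dg
  set r := √(ξ + 1) with hr
  set s := √(ξ + 1 + 1) with hs
  have hr2 : r ^ 2 = ξ + 1 := Real.sq_sqrt (by linarith)
  have hs2 : s ^ 2 = ξ + 1 + 1 := Real.sq_sqrt (by linarith)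
  have hsr : r ≤ s := Real.sqrt_le_sqrt (by linarith)
  have hr1 : 1 ≤ r := Real.one_le_sqrt.2 (by linarith)
  obtain ⟨d, hd⟩ : ∃ d, d = s - r := ⟨_, rfl⟩
  have hd0 : 0 ≤ d := by linarith
  have hsd : s = r + d := by linarith
  have hdd : 2 * r * d + d ^ 2 = 1 := by rw [hsd] at hs2; nlinarith
  have e1 : Real.exp (c * s) = Real.exp (c * r) * Real.exp (c * d) := by
    rw [← Real.exp_add, hsd]; ring_nf
  have e2 := Real.quadratic_le_exp_of_nonneg (mul_nonneg hc hd0)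
  have hE := Real.exp_pos (c * r)
  have hξ : ξ = r^2 - 1 := by linarith
  have hd1 : 2 * r * d ≤ 1 := by nlinarith
  have hd2 : d ≤ 1 / 2 := by nlinarith
  have k1 : 3 / 8 ≤ r * d := by nlinarith
  have k2 : (r^2 - 1) / (2 * r) ≤ r^2 * d := by
    rw [div_le_iff₀ (by positivity)]
    -- need r^2 - 1 ≤ 2 r^3 d = r^2 (1 - d^2)
    have : r^2 * d * (2 * r) = r^2 - (r*d)^2 := by
      have : 2 * r * d = 1 - d^2 := by linarith
      calc r^2 * d * (2 * r) = r^2 * (2 * r * d) := by ring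
        _ = _ := by rw [this]; ring
    rw [this]
    nlinarith
  have k3 : (9:ℝ) / 64 ≤ (r * d)^2 := by nlinarith
  have hρ0 : 0 ≤ c^2 := sq_nonneg c
  have k4 := mul_le_mul_of_nonneg_left k2 hc
  have k5 := mul_le_mul_of_nonneg_left k3 hρ0
  have k6 : ξ + (1 + c * (ξ / (2 * r))) + ρ ≤ (ξ + 1) * (1 + c * d + (c * d)^2/2) := by
    rw [hξ]
    nlinarith
  have k7 : (ξ + 1) * (1 + c * d + (c * d)^2/2) ≤ (ξ + 1) * Real.exp (c * d) := by
    gcongr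
  rw [e1]
  have := mul_le_mul_of_nonneg_left (k6.trans k7) hE.le
  nlinarith

lemma g_step {c ρ ξ δ : ℝ} (hρ : 0 < ρ) (hc : 0 ≤ c) (hcρ : c ^ 2 = 16 * ρ) (h0 : 0 ≤ ξ)
    (hδ : 0 ≤ δ) (hδ1 : δ ≤ 1) :
    0 ≤ Real.exp (-ρ * δ) * g c (ξ - ξ * δ) - g c ξ + (g c (ξ + 1) - g c ξ) * (ξ * δ) := by
  have hξδ : 0 ≤ ξ * δ := by positivity
  have h1 : 0 ≤ ξ - ξ * δ := by nlinarith
  have h2 : ξ - ξ * δ ≤ ξ := by linarith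
  have a1 := g_tangent hc h1 h2
  have a2 := g_mono hc h1 h2
  have a3 := g_succ hc hcρ h0
  have a4 := Real.add_one_le_exp (-ρ * δ)
  have a5 := g_nonneg (c := c) h1
  have a6 := mul_le_mul_of_nonneg_right a4 a5
  have a7 := mul_le_mul_of_nonneg_left a2 (mul_nonneg hρ.le hδ)
  have a8 := mul_le_mul_of_nonneg_right a3 hξδ
  have a9 : g c ξ = ξ * Real.exp (c * √(ξ + 1)) := rfl
  have a10 : ρ * δ * g c ξ = ρ * Real.exp (c * √(ξ + 1)) * (ξ * δ) := by rw [a9]; ring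
  nlinarith

lemma dg_nonneg {c ξ : ℝ} (hc : 0 ≤ c) (h0 : 0 ≤ ξ) : 0 ≤ dg c ξ := by
  unfold dg; positivity

lemma dg_le {c ξ N : ℝ} (hc : 0 ≤ c) (h0 : 0 ≤ ξ) (h : ξ ≤ N) :
    dg c ξ ≤ Real.exp (c * √(N + 1)) * (1 + c * N) := by
  unfold dg
  have hr1 : 1 ≤ √(ξ + 1) := Real.one_le_sqrt.2 (by linarith)
  have : ξ / (2 * √(ξ + 1)) ≤ N := by
    rw [div_le_iff₀ (by positivity)]
    nlinarith
  gcongr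

lemma g_lip {c ξ η N : ℝ} (hc : 0 ≤ c) (h0 : 0 ≤ ξ) (h : ξ ≤ N) (h0' : 0 ≤ η) (h' : η ≤ N) :
    |g c ξ - g c η| ≤ Real.exp (c * √(N + 1)) * (1 + c * N) * |ξ - η| := by
  wlog hh : η ≤ ξ generalizing ξ η
  · rw [abs_sub_comm, abs_sub_comm ξ η]
    exact this h0' h' h0 h (by linarith)
  have a1 := g_tangent hc h0' hh
  have a2 := g_mono hc h0' hh
  rw [abs_of_nonneg (by linarith), abs_of_nonneg (by linarith)]
  have := mul_le_mul_of_nonneg_right (dg_le hc h0 h) (sub_nonneg.2 hh)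
  linarith

lemma sq_le_exp {r : ℝ} (hr : 0 ≤ r) : r ^ 2 ≤ Real.exp (r + 1) := by
  have h1 := Real.quadratic_le_exp_of_nonneg hr
  have h2 : 2 ≤ Real.exp 1 := by linarith [Real.add_one_le_exp (1:ℝ)]
  rw [Real.exp_add]
  have h3 : r^2/2 ≤ Real.exp r := by linarith
  have := mul_le_mul h3 h2 (by norm_num) (Real.exp_pos r).le
  linarith

lemma exp_quad {q : ℝ} (h0 : 0 ≤ q) (h1 : q ≤ 1) : Real.exp q - 1 - q ≤ q ^ 2 := by
  have := Real.abs_exp_sub_one_sub_id_le (x := q) (by rwa [abs_of_nonneg h0])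
  exact (le_abs_self _).trans this

lemma g_final {c p a ξ κ : ℝ} (hc : 0 ≤ c) (hp : 1 ≤ p) (hξ : 0 ≤ ξ)
    (hκa : κ * a ≤ p + 1) :
    g c ξ ≤ Real.exp ((c + 1) * ((c + 7) * p) + 1) + Real.exp (ξ / p - κ * a - 2) := by
  set r := √(ξ + 1) with hr
  have hr2 : r ^ 2 = ξ + 1 := Real.sq_sqrt (by linarith)
  have hr1 : 1 ≤ r := Real.one_le_sqrt.2 (by linarith)
  have h1 := sq_le_exp (r := r) (by linarith)
  have h2 : g c ξ ≤ Real.exp ((c + 1) * r + 1) := by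
    calc g c ξ = ξ * Real.exp (c * r) := rfl
      _ ≤ Real.exp (r + 1) * Real.exp (c * r) := by gcongr; linarith
      _ = _ := by rw [← Real.exp_add]; ring_nf
  rcases le_total r ((c + 7) * p) with h | h
  · have : Real.exp ((c + 1) * r + 1) ≤ Real.exp ((c + 1) * ((c + 7) * p) + 1) := by
      gcongr
    linarith [Real.exp_pos (ξ / p - κ * a - 2)]
  · have : Real.exp ((c + 1) * r + 1) ≤ Real.exp (ξ / p - κ * a - 2) := by
      apply Real.exp_le_exp.2
      have e1 : (c + 7) * r - 1 ≤ ξ / p := by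
        rw [le_div_iff₀ (by linarith)]
        have : (c + 7) * p * r ≤ r * r := by gcongr
        nlinarith
      have : 7 * p ≤ r := by nlinarith
      nlinarith
    linarith [Real.exp_pos ((c + 1) * ((c + 7) * p) + 1)]

end YSAux

open YSAux in
lemma YuleSimonSetup.tail_lb {ρ : ℝ} (S : YuleSimonSetup 1 ρ) (hρ : 0 < ρ) (n : ℕ) (hn : 1 ≤ n)
    (p : ℝ) (hp : 1 ≤ p) (hpn : p ^ 3 = n) :
    1 / 2 ≤ Real.exp ((4 * √ρ + 1) * ((4 * √ρ + 7) * p) + 1) * (S.tail n).toReal := by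
  set c := 4 * √ρ with hcdef
  have hc : 0 ≤ c := by positivity
  have hcρ : c ^ 2 = 16 * ρ := by rw [hcdef, mul_pow, Real.sq_sqrt hρ.le]; norm_num
  set q := 1 / p with hqdef
  have hq0 : 0 ≤ q := by positivity
  have hq1 : q ≤ 1 := by rw [hqdef, div_le_one (by linarith)]; exact hp
  have hqp : q * p = 1 := by rw [hqdef]; field_simp
  set κ := Real.exp q - 1 - q with hκ
  have hκ0 : 0 ≤ κ := by linarith [Real.add_one_le_exp q]
  have hκ1 : κ ≤ q^2 := exp_quad hq0 hq1
  set r := q + κ with hrdef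
  have hr : 0 ≤ r := by linarith
  set B := Real.exp (q * n - 2) with hB
  have hBp : 0 < B := Real.exp_pos _
  set G := Real.exp (c * √((n:ℝ) + 1)) * (1 + c * n) with hG
  have hGp : 0 ≤ G := by positivity
  have hgp : 0 ≤ g c n := g_nonneg (by positivity)
  set C := (B + g c n) + (B * r + G) + B * (r * n + ρ)^2 with hC
  have n1 : 0 ≤ B * r + G := by positivity
  have n2 : 0 ≤ B * (r * n + ρ)^2 := by positivity
  set M := Real.exp ((c + 1) * ((c + 7) * p) + 1) with hM
  have key := S.dynkin hρ n hn (fun k a => zf q r 2 k a - g c (k - a)) C (-M) (by positivity)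
    (by
      intro k
      refine (zf_meas _ _ _ _).sub ?_
      unfold g
      fun_prop)
    (by
      intro k a hk h0 h1
      have hk' : (k:ℝ) ≤ n := by exact_mod_cast hk
      have i1 := zf_le (m := 2) hq0 hr hk h0
      have i2 := zf_pos q r 2 k a
      have i3 : 0 ≤ g c (k - a) := g_nonneg (by linarith)
      have i4 : g c (k - a) ≤ g c n := g_mono hc (by linarith) (by linarith)
      rw [abs_le]
      constructor <;> linarith)
    (by
      intro k a b hk h0 h1 h2 h3
      have hk' : (k:ℝ) ≤ n := by exact_mod_cast hk
      have i1 := zf_lip (m := 2) hq0 hr hk h0 h2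
      have i2 := g_lip (c := c) (ξ := k - b) (η := k - a) (N := n) hc (by linarith) (by linarith)
        (by linarith) (by linarith)
      rw [show (k:ℝ) - b - (k - a) = a - b by ring] at i2
      rw [show zf q r 2 k a - g c (k - a) - (zf q r 2 k b - g c (k - b))
        = (zf q r 2 k a - zf q r 2 k b) + (g c (k - b) - g c (k - a)) by ring]
      refine (abs_add_le _ _).trans ((add_le_add i1 i2).trans ?_)
      rw [← add_mul]
      gcongr
      linarith)
    (by
      intro a h0 h1
      have i1 : κ * a ≤ p + 1 := by
        push_cast at h1
        rw [← hpn] at h1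
        calc κ * a ≤ q^2 * (p^3 + 1) := by gcongr
          _ = (q*p)^2 * p + q^2 := by ring
          _ ≤ p + 1 := by rw [hqp]; nlinarith
      have i2 := g_final (c := c) (ξ := (n+1:ℕ) - a) hc hp (by linarith) i1
      have i3 : zf q r 2 (n+1) a = Real.exp (((n+1:ℕ) - a) / p - κ * a - 2) := by
        unfold zf
        rw [hrdef, div_eq_mul_one_div, ← hqdef]
        congr 1
        ring
      rw [← i3] at i2
      linarith)
    (by
      intro k a δ hk h0 h1 h2 h3
      have j1 := zf_step (m := 2) hρ hq0 hr hk h0 h1 h2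
      have j2 := g_step (c := c) (ξ := k - a) hρ hc hcρ (by linarith) h2 h3
      have l0 : (Real.exp q - 1 - r) * (k - a) - ρ ≤ 0 := by
        rw [hrdef, hκ]
        have : (Real.exp q - 1 - (q + (Real.exp q - 1 - q))) * (k - a) = 0 := by ring
        linarith
      have l4 : zf q r 2 k a * (((Real.exp q - 1 - r) * (k - a) - ρ) * δ) ≤ 0 :=
        mul_nonpos_of_nonneg_of_nonpos (zf_pos _ _ _ _ _).le
          (mul_nonpos_of_nonpos_of_nonneg l0 h2)
      have l5 : B * (r * n + ρ)^2 * δ^2 ≤ C * δ^2 := by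
        gcongr; linarith
      have e1 : (k:ℝ) - (a + (k - a) * δ) = (k - a) - (k - a) * δ := by ring
      have e2 : ((k+1 : ℕ):ℝ) - a = (k - a) + 1 := by push_cast; ring
      rw [e1, e2]
      nlinarith)
  have f1 : zf q r 2 1 0 ≤ 1 / 2 := by
    unfold zf
    have h2 : 2 ≤ Real.exp 1 := by linarith [Real.add_one_le_exp (1:ℝ)]
    calc Real.exp (q * (1:ℕ) - r * 0 - 2) ≤ Real.exp (-1) := by
          apply Real.exp_le_exp.2; push_cast; linarith
      _ = (Real.exp 1)⁻¹ := Real.exp_neg 1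
      _ ≤ 2⁻¹ := by gcongr
      _ = 1 / 2 := by norm_num
  have f2 : 1 ≤ g c ((1:ℕ) - 0) := by
    unfold g
    push_cast
    rw [sub_zero, one_mul]
    apply Real.one_le_exp
    positivity
  linarith

namespace YSAux

lemma exp_cubic {q : ℝ} (h0 : 0 ≤ q) (h1 : q ≤ 1) : Real.exp q - 1 - q ≤ q ^ 2 / 2 + q ^ 3 := by
  have := Real.exp_bound' h0 h1 (n := 3) (by norm_num)
  simp [Finset.sum_range_succ, Nat.factorial] at this
  nlinarith [pow_nonneg h0 3]

end YSAux

open YSAux in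
lemma YuleSimonSetup.tail_ub2 {ρ : ℝ} (S : YuleSimonSetup 1 ρ) (hρ : 0 < ρ) (n : ℕ) (hn : 1 ≤ n)
    (w p : ℝ) (hw : 0 < w) (hwρ : w ^ 3 = 2 * ρ) (hp : 1 ≤ p) (hpw : 2 * w ≤ p)
    (hpn : p ^ 3 = n) :
    (S.tail n).toReal ≤ Real.exp (2 + 5 / 4 * w ^ 3 - w ^ 2 / 2 * p) := by
  have hp0 : 0 < p := by linarith
  set q := w / p with hq
  have hqp : q * p = w := by rw [hq]; field_simp
  have hq0 : 0 < q := by positivity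
  have hq1 : q ≤ 1 / 2 := by rw [hq, div_le_iff₀ hp0]; linarith
  set c := q ^ 2 / 2 - q ^ 3 with hc
  have hc0 : 0 ≤ c := by
    have : c = q^2 * (1/2 - q) := by rw [hc]; ring
    rw [this]
    exact mul_nonneg (sq_nonneg q) (by linarith)
  have hcq : c ≤ q := by nlinarith [pow_pos hq0 3]
  set K := w * p ^ 2 / 2 with hK
  have hK0 : 0 < K := by positivity
  have h1 : (Real.exp q - 1 - q + c) * K ≤ ρ := by
    have := exp_cubic hq0.le (by linarith)
    calc (Real.exp q - 1 - q + c) * K ≤ q^2 * K := by gcongr; linarith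
      _ = (q * p)^2 * w / 2 := by rw [hK]; ring
      _ = w^3 / 2 := by rw [hqp]; ring
      _ = ρ := by linarith
      _ ≤ ρ := le_rfl
  have h2 := S.tail_ub hρ n hn q c K hc0 hcq hK0 h1
  have e1 : q * (1 - K) ≤ 1 + 5 / 4 * w ^ 3 - w ^ 2 / 2 * p := by
    have : q * K = w^2/2 * p := by
      calc q * K = (q * p) * w / 2 * p := by rw [hK]; ring
        _ = _ := by rw [hqp]; ring
    have := pow_pos hw 3
    linarith
  have e2 : q - c * (n + 1 - K) ≤ 1 + 5 / 4 * w ^ 3 - w ^ 2 / 2 * p := by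
    have a1 : c * (p^3 - K) = w^2 / 2 * p - 5/4 * w^3 + w^3 * q / 2 := by
      calc c * (p^3 - K) = (q*p)^2 / 2 * p - (q * p)^3 - (q*p)^2*w/4 + (q * p)^2 * w * q/2 := by
            rw [hc, hK]; ring
        _ = _ := by rw [hqp]; ring
    have : 0 ≤ w^3 * q / 2 := by positivity
    rw [← hpn]
    nlinarith
  have h3 : 2 ≤ Real.exp 1 := by linarith [Real.add_one_le_exp (1:ℝ)]
  set T := 1 + 5 / 4 * w ^ 3 - w ^ 2 / 2 * p with hT
  calc (S.tail n).toReal ≤ _ := h2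
    _ ≤ Real.exp T + Real.exp T := add_le_add (Real.exp_le_exp.2 e1) (Real.exp_le_exp.2 e2)
    _ = 2 * Real.exp T := by ring
    _ ≤ Real.exp 1 * Real.exp T := by gcongr
    _ = _ := by rw [← Real.exp_add, hT]; congr 1; ring

open Filter in
/-- Critical case `θ = 1`: stretched-exponential upper bound,
`limsup_{n→∞} n^{-1/3} ln P(X_{1,ρ} > n) ≤ −(1/2)^{1/3} ρ^{2/3}`. -/
theorem yule_simon_critical_upper_bound (ρ : ℝ) (hρ : 0 < ρ)
    (S : YuleSimonSetup 1 ρ) :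
    Filter.limsup
        (fun n : ℕ => (n : ℝ) ^ (-(1/3) : ℝ) * Real.log (S.tail n).toReal) atTop
      ≤ -(1/2 : ℝ) ^ ((1:ℝ)/3) * ρ ^ ((2:ℝ)/3) := by
  set w : ℝ := (2 * ρ) ^ ((1:ℝ)/3) with hw
  have hw0 : 0 < w := by positivity
  have hw3 : w ^ 3 = 2 * ρ := by
    rw [hw, ← Real.rpow_natCast, ← Real.rpow_mul (by positivity)]
    norm_num
  have htarget : -(1/2 : ℝ) ^ ((1:ℝ)/3) * ρ ^ ((2:ℝ)/3) = -(w ^ 2 / 2) := by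
    have hρw : ρ = w ^ 3 * (1/2) := by linarith
    have hhalf : (1/2 : ℝ) ^ ((1:ℝ)/3) * (1/2 : ℝ) ^ ((2:ℝ)/3) = 1/2 := by
      rw [← Real.rpow_add (by norm_num)]; norm_num
    have h2 : ρ ^ ((2:ℝ)/3) = w ^ 2 * (1/2 : ℝ) ^ ((2:ℝ)/3) := by
      conv_lhs => rw [hρw]
      rw [Real.mul_rpow (by positivity) (by norm_num), ← Real.rpow_natCast w 3,
        ← Real.rpow_mul hw0.le, ← Real.rpow_natCast w 2]
      norm_num
    rw [h2]
    linear_combination (-(w ^ 2)) * hhalf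
  rw [htarget]
  set D := 2 + 5 / 4 * w ^ 3 with hD
  set L := (4 * √ρ + 1) * (4 * √ρ + 7) with hL
  -- p n = n^{1/3}
  have hpt : Tendsto (fun n : ℕ => (n:ℝ) ^ ((1:ℝ)/3)) atTop atTop :=
    (tendsto_rpow_atTop (by norm_num)).comp tendsto_natCast_atTop_atTop
  have hcube : ∀ n : ℕ, ((n:ℝ) ^ ((1:ℝ)/3)) ^ 3 = n := by
    intro n
    rw [← Real.rpow_natCast, ← Real.rpow_mul (by positivity)]
    norm_num
  have hinv : ∀ n : ℕ, (n:ℝ) ^ (-(1/3) : ℝ) = ((n:ℝ) ^ ((1:ℝ)/3))⁻¹ := by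
    intro n
    rw [← Real.rpow_neg (by positivity)]
  have hbounds : ∀ᶠ n : ℕ in atTop,
      -(L + 2) ≤ (n : ℝ) ^ (-(1/3) : ℝ) * Real.log (S.tail n).toReal ∧
      (n : ℝ) ^ (-(1/3) : ℝ) * Real.log (S.tail n).toReal
        ≤ D * ((n:ℝ) ^ ((1:ℝ)/3))⁻¹ - w ^ 2 / 2 := by
    filter_upwards [hpt.eventually_ge_atTop 1, hpt.eventually_ge_atTop (2 * w),
      eventually_ge_atTop 1] with n h1 h2 hn
    rw [hinv]
    have h3 := hcube n
    set p := (n:ℝ) ^ ((1:ℝ)/3) with hp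
    have hp0 : 0 < p := by linarith
    have hlo := S.tail_lb hρ n hn p h1 h3
    have hup := S.tail_ub2 hρ n hn w p hw0 hw3 h1 h2 h3
    rw [show (4 * √ρ + 1) * ((4 * √ρ + 7) * p) = L * p by rw [hL]; ring] at hlo
    set t := (S.tail n).toReal with ht
    have hE := Real.exp_pos (L * p + 1)
    have htpos : 0 < t := by
      by_contra hcon
      push Not at hcon
      have := mul_nonpos_of_nonneg_of_nonpos hE.le hcon
      linarith
    have hlog_up : Real.log t ≤ D - w ^ 2 / 2 * p := by
      have := Real.log_le_log htpos hup
      rwa [Real.log_exp] at this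
    have hlog_lo : -(L + 2) * p ≤ Real.log t := by
      have h := Real.log_le_log (by norm_num) hlo
      rw [Real.log_mul hE.ne' htpos.ne', Real.log_exp, one_div, Real.log_inv] at h
      have : Real.log 2 ≤ 1 := by
        have := Real.log_le_sub_one_of_pos (show (0:ℝ) < 2 by norm_num)
        linarith
      nlinarith
    have hpi : 0 < p⁻¹ := by positivity
    constructor
    · have := mul_le_mul_of_nonneg_left hlog_lo hpi.le
      have e : p⁻¹ * (-(L + 2) * p) = -(L + 2) := by field_simp
      linarith
    · have := mul_le_mul_of_nonneg_left hlog_up hpi.le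
      have e : p⁻¹ * (D - w ^ 2 / 2 * p) = D * p⁻¹ - w ^ 2 / 2 := by field_simp
      linarith
  have hlim : Tendsto (fun n : ℕ => D * ((n:ℝ) ^ ((1:ℝ)/3))⁻¹ - w ^ 2 / 2) atTop
      (nhds (-(w ^ 2 / 2))) := by
    have := ((tendsto_inv_atTop_zero.comp hpt).const_mul D).sub_const (w ^ 2 / 2)
    simpa using this
  have hcob : IsCoboundedUnder (· ≤ ·) atTop
      (fun n : ℕ => (n : ℝ) ^ (-(1/3) : ℝ) * Real.log (S.tail n).toReal) :=
    isCoboundedUnder_le_of_eventually_le atTop (hbounds.mono fun n h => h.1)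
  rw [← hlim.limsup_eq]
  exact limsup_le_limsup (hbounds.mono fun n h => h.2) hcob hlim.isBoundedUnder_le
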